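/- arXiv:1902.08435 — 3 statements merged into one kernel-verified Lean document; each statement's English description precedes it below -/
import Mathlib

section
/- Let δ ∈ (0,1) and ε > 0 be fixed. Then #𝓔_δ^{(2)}(X) ≪ X^{5/6 − δ + ε} + X^{2/3 + ε}, with implied constant depending only on δ and ε. -/
/-- The set `𝓔_δ(X)` of quadruples `(A, B, m, ℓ)` of nonzero integers (with `ℓ ≥ 1`) such that
`|A|³ ≤ X`, `B² ≤ X`, `ℓ > X^δ` and `4A³ + 27B² = mℓ²`. -/
def Eset (δ X : ℝ) : Set (ℤ × ℤ × ℤ × ℤ) :=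
  {t | t.1 ≠ 0 ∧ t.2.1 ≠ 0 ∧ t.2.2.1 ≠ 0 ∧ 1 ≤ t.2.2.2 ∧
    (|t.1| ^ 3 : ℝ) ≤ X ∧ ((t.2.1 : ℝ) ^ 2 : ℝ) ≤ X ∧ X ^ δ < (t.2.2.2 : ℝ) ∧
    4 * t.1 ^ 3 + 27 * t.2.1 ^ 2 = t.2.2.1 * t.2.2.2 ^ 2}

/-- The subset `𝓔_δ^{(1)}(X)` where moreover `ℓ > X^{1/3}`. -/
def Eset1 (δ X : ℝ) : Set (ℤ × ℤ × ℤ × ℤ) :=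
  {t ∈ Eset δ X | X ^ ((1 : ℝ) / 3) < (t.2.2.2 : ℝ)}

/-- The subset `𝓔_δ^{(2)}(X) = 𝓔_δ(X) ∖ 𝓔_δ^{(1)}(X)`. -/
def Eset2 (δ X : ℝ) : Set (ℤ × ℤ × ℤ × ℤ) := Eset δ X \ Eset1 δ X

/-- The divisor bound `d(n) ≪_ε n^ε`. -/
theorem exists_card_divisors_le_rpow {ε : ℝ} (hε : 0 < ε) :
    ∃ C : ℝ, 1 ≤ C ∧ ∀ n : ℕ, n ≠ 0 → (n.divisors.card : ℝ) ≤ C * (n : ℝ) ^ ε := by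
  have h2 : 1 < (2 : ℝ) ^ ε := Real.one_lt_rpow (by norm_num) hε
  set K : ℝ := 1 + 1 / ((2 : ℝ) ^ ε - 1) with hK
  have hK1 : 1 ≤ K := by
    have : 0 ≤ 1 / ((2 : ℝ) ^ ε - 1) := by
      apply div_nonneg <;> linarith
    linarith
  obtain ⟨P, hP⟩ : ∃ P : ℕ, ∀ p : ℕ, P ≤ p → 2 ≤ (p : ℝ) ^ ε := by
    have := ((tendsto_rpow_atTop hε).comp tendsto_natCast_atTop_atTop).eventually_ge_atTop 2
    simpa using Filter.eventually_atTop.1 this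
  have hsmall : ∀ p k : ℕ, 2 ≤ p → (k + 1 : ℝ) ≤ K * ((p : ℝ) ^ ε) ^ k := by
    intro p k hp
    have hmono : (2 : ℝ) ^ ε ≤ (p : ℝ) ^ ε :=
      Real.rpow_le_rpow (by norm_num) (by exact_mod_cast hp) hε.le
    have hb : 1 + (k : ℝ) * ((2 : ℝ) ^ ε - 1) ≤ ((2 : ℝ) ^ ε) ^ k := by
      have := one_add_mul_le_pow (a := (2 : ℝ) ^ ε - 1) (by linarith) k
      simpa using this
    have hc : ((2 : ℝ) ^ ε) ^ k ≤ ((p : ℝ) ^ ε) ^ k := by gcongr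
    have hd : (k + 1 : ℝ) ≤ K * (1 + (k : ℝ) * ((2 : ℝ) ^ ε - 1)) := by
      have hne : (2 : ℝ) ^ ε - 1 ≠ 0 := by linarith
      have : K * (1 + (k : ℝ) * ((2 : ℝ) ^ ε - 1)) =
          K + k * ((2 : ℝ) ^ ε - 1) + k := by
        rw [hK]; field_simp; ring
      have h3 : 0 ≤ (k : ℝ) * ((2 : ℝ) ^ ε - 1) := mul_nonneg (by positivity) (by linarith)
      linarith
    calc (k + 1 : ℝ) ≤ _ := hd
      _ ≤ _ := by gcongr; exact hb.trans hc
  have hlarge : ∀ p k : ℕ, P ≤ p → (k + 1 : ℝ) ≤ ((p : ℝ) ^ ε) ^ k := by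
    intro p k hp
    have h1 : (k + 1 : ℝ) ≤ 2 ^ k := by exact_mod_cast Nat.lt_two_pow_self (n := k)
    exact h1.trans (by gcongr; exact hP p hp)
  refine ⟨K ^ P, one_le_pow₀ hK1, fun n hn => ?_⟩
  have hn' : (n : ℝ) ^ ε = ∏ p ∈ n.primeFactors, ((p : ℝ) ^ ε) ^ n.factorization p := by
    conv_lhs => rw [← Nat.prod_factorization_pow_eq_self hn]
    rw [Finsupp.prod, Nat.support_factorization, Nat.cast_prod,
      ← Real.finsetProd_rpow _ _ (fun i _ => by positivity)]
    refine Finset.prod_congr rfl fun p _ => ?_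
    rw [Nat.cast_pow, ← Real.rpow_natCast, ← Real.rpow_natCast, ← Real.rpow_mul (by positivity),
      ← Real.rpow_mul (by positivity), mul_comm]
  rw [Nat.card_divisors hn, hn', Nat.cast_prod]
  calc ∏ p ∈ n.primeFactors, ((n.factorization p + 1 : ℕ) : ℝ)
      ≤ ∏ p ∈ n.primeFactors,
          (if p < P then K else 1) * ((p : ℝ) ^ ε) ^ n.factorization p := by
        refine Finset.prod_le_prod (fun _ _ => by positivity) fun p hp => ?_
        push_cast
        split_ifs with h
        · exact hsmall p _ (Nat.prime_of_mem_primeFactors hp).two_le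
        · rw [one_mul]; exact hlarge p _ (not_lt.1 h)
    _ = K ^ (n.primeFactors.filter (· < P)).card *
          ∏ p ∈ n.primeFactors, ((p : ℝ) ^ ε) ^ n.factorization p := by
        rw [Finset.prod_mul_distrib, ← Finset.prod_filter, Finset.prod_const]
    _ ≤ _ := by
        gcongr
        calc (n.primeFactors.filter (· < P)).card ≤ (Finset.range P).card := by
              apply Finset.card_le_card
              intro p hp
              simpa using (Finset.mem_filter.1 hp).2
          _ = P := Finset.card_range P

/-- A finite set of integers in `[-M, M]` whose differences, multiplied by `c`, are all divisible
by `n` has at most `2cM/n + 1` elements. -/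
theorem card_le_of_dvd_mul_sub {c n : ℕ} (hc : 0 < c) (hn : 0 < n) {M : ℝ} (hM : 0 ≤ M)
    {S : Finset ℤ} (hS : ∀ x ∈ S, |(x : ℝ)| ≤ M)
    (h : ∀ x ∈ S, ∀ y ∈ S, (n : ℤ) ∣ c * (x - y)) :
    (S.card : ℝ) ≤ 2 * c * M / n + 1 := by
  rcases S.eq_empty_or_nonempty with rfl | hne
  · simp only [Finset.card_empty, Nat.cast_zero]; positivity
  have hmin := S.min'_mem hne
  set x₀ := S.min' hne
  have hcard : S.card ≤ (Finset.range (⌊2 * c * M / n⌋₊ + 1)).card := by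
    refine Finset.card_le_card_of_injOn (fun x => ((c * (x - x₀)) / n).toNat) ?_ ?_
    · intro x hx
      obtain ⟨k, hk⟩ := h x hx x₀ hmin
      have hle : x₀ ≤ x := S.min'_le x hx
      have hn0 : (n : ℤ) ≠ 0 := by positivity
      simp only [Finset.coe_range, Set.mem_Iio, hk]
      rw [Int.mul_ediv_cancel_left _ hn0, Nat.lt_succ_iff]
      apply Nat.le_floor
      have hk0 : 0 ≤ k := by
        have h0 : 0 ≤ (c : ℤ) * (x - x₀) := mul_nonneg (by positivity) (by linarith)
        rw [hk] at h0
        exact nonneg_of_mul_nonneg_right h0 (by positivity)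
      have hcast : ((k.toNat : ℕ) : ℝ) = (k : ℝ) := by
        exact_mod_cast congrArg (Int.cast : ℤ → ℝ) (Int.toNat_of_nonneg hk0)
      rw [hcast, le_div_iff₀ (by positivity)]
      have hk' : (c : ℝ) * (x - x₀) = n * k := by exact_mod_cast hk
      have h1 := abs_le.1 (hS x hx)
      have h2 := abs_le.1 (hS x₀ hmin)
      have h3 : (c : ℝ) * (x - x₀) ≤ c * (2 * M) := by gcongr; linarith
      linarith
    · intro x hx y hy hxy
      obtain ⟨k, hk⟩ := h x hx x₀ hmin
      obtain ⟨j, hj⟩ := h y hy x₀ hmin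
      have hlex : x₀ ≤ x := S.min'_le x hx
      have hley : x₀ ≤ y := S.min'_le y hy
      have hn0 : (n : ℤ) ≠ 0 := by positivity
      have hnp : (0 : ℤ) < n := by positivity
      have hcp : (0 : ℤ) < c := by positivity
      have hk0 : 0 ≤ k := by
        have h0 : 0 ≤ (c : ℤ) * (x - x₀) := mul_nonneg (by positivity) (by linarith)
        rw [hk] at h0
        exact nonneg_of_mul_nonneg_right h0 hnp
      have hj0 : 0 ≤ j := by
        have h0 : 0 ≤ (c : ℤ) * (y - x₀) := mul_nonneg (by positivity) (by linarith)
        rw [hj] at h0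
        exact nonneg_of_mul_nonneg_right h0 hnp
      simp only [hk, hj] at hxy
      rw [Int.mul_ediv_cancel_left _ hn0, Int.mul_ediv_cancel_left _ hn0] at hxy
      have hkj : k = j := by omega
      rw [hkj, ← hj] at hk
      have := mul_left_cancel₀ hcp.ne' hk
      linarith
  rw [Finset.card_range] at hcard
  calc (S.card : ℝ) ≤ ((⌊2 * c * M / n⌋₊ + 1 : ℕ) : ℝ) := by exact_mod_cast hcard
    _ ≤ _ := by
      push_cast
      gcongr
      exact Nat.floor_le (by positivity)

/-- The number of `B ∈ [-M, M]` with `ℓ² ∣ 4A³ + 27B²`, bounded in terms of common divisors of `ℓ`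
and `432A³`. -/
theorem card_sq_dvd_le {A : ℤ} (hA : A ≠ 0) {l : ℕ} (hl : 0 < l) {M : ℝ} (hM : 0 ≤ M)
    {S : Finset ℤ} (hS : ∀ x ∈ S, |(x : ℝ)| ≤ M)
    (h : ∀ B ∈ S, ((l : ℤ) ^ 2) ∣ 4 * A ^ 3 + 27 * B ^ 2) :
    (S.card : ℝ) ≤ (l ^ 2).divisors.card *
      (1 + 54 * M * ∑ d ∈ (432 * A.natAbs ^ 3).divisors with d ∣ l, (d : ℝ) / (l : ℝ) ^ 2) := by
  set D : ℝ := ∑ d ∈ (432 * A.natAbs ^ 3).divisors with d ∣ l, (d : ℝ) / (l : ℝ) ^ 2 with hD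
  have hD0 : 0 ≤ D := Finset.sum_nonneg fun _ _ => by positivity
  rcases S.eq_empty_or_nonempty with rfl | ⟨B₀, hB₀⟩
  · simp only [Finset.card_empty, Nat.cast_zero]; positivity
  let T : ℕ × ℕ → Finset ℤ := fun p =>
    {B ∈ S | (p.1 : ℤ) ∣ 27 * (B - B₀) ∧ (p.2 : ℤ) ∣ 27 * (B + B₀)}
  have hcover : S ⊆ (l ^ 2).divisorsAntidiagonal.biUnion T := by
    intro B hB
    have hdvd : ((l : ℤ) ^ 2) ∣ (27 * (B - B₀)) * (27 * (B + B₀)) := by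
      exact ((dvd_sub (h B hB) (h B₀ hB₀)).mul_left 27).trans
        (dvd_of_eq (by ring))
    obtain ⟨d, e, hd, he, hde⟩ := exists_dvd_and_dvd_of_dvd_mul hdvd
    refine Finset.mem_biUnion.2 ⟨(d.natAbs, e.natAbs), ?_, ?_⟩
    · rw [Nat.mem_divisorsAntidiagonal]
      refine ⟨?_, by positivity⟩
      have := congrArg Int.natAbs hde
      rw [Int.natAbs_mul, Int.natAbs_pow, Int.natAbs_natCast] at this
      exact this.symm
    · simp only [T, Finset.mem_filter, Int.natAbs_dvd]
      exact ⟨hB, hd, he⟩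
  have hT : ∀ p ∈ (l ^ 2).divisorsAntidiagonal, ((T p).card : ℝ) ≤ 1 + 54 * M * D := by
    rintro ⟨d, e⟩ hp
    obtain ⟨hde, -⟩ := Nat.mem_divisorsAntidiagonal.1 hp
    simp only at hde
    rcases (T (d, e)).eq_empty_or_nonempty with hemp | ⟨B₁, hB₁⟩
    · rw [hemp]; simp only [Finset.card_empty, Nat.cast_zero]; positivity
    have hpos : 0 < d * e := hde ▸ by positivity
    have hd0 : 0 < d := Nat.pos_of_ne_zero (by rintro rfl; simp at hpos)
    have he0 : 0 < e := Nat.pos_of_ne_zero (by rintro rfl; simp at hpos)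
    obtain ⟨hB₁S, hB₁d, hB₁e⟩ := Finset.mem_filter.1 hB₁
    simp only at hB₁d hB₁e
    have hgl : d.gcd e ∣ l := by
      rw [← Nat.pow_dvd_pow_iff two_ne_zero, ← hde, sq]
      exact mul_dvd_mul (Nat.gcd_dvd_left d e) (Nat.gcd_dvd_right d e)
    have hgA : d.gcd e ∣ 432 * A.natAbs ^ 3 := by
      have h1 : ((d.gcd e : ℕ) : ℤ) ∣ 54 * B₁ :=
        (dvd_add ((Int.natCast_dvd_natCast.2 (Nat.gcd_dvd_left d e)).trans hB₁d)
          ((Int.natCast_dvd_natCast.2 (Nat.gcd_dvd_right d e)).trans hB₁e)).trans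
          (dvd_of_eq (by ring))
      have h2 : ((d.gcd e : ℕ) : ℤ) ∣ 4 * A ^ 3 + 27 * B₁ ^ 2 :=
        ((Int.natCast_dvd_natCast.2 hgl).trans (dvd_pow_self _ two_ne_zero)).trans (h B₁ hB₁S)
      have h3 : ((d.gcd e : ℕ) : ℤ) ∣ 432 * A ^ 3 :=
        (dvd_sub (h2.mul_left 108) (h1.mul_left (54 * B₁))).trans
          (dvd_of_eq (by ring))
      have := Int.natAbs_dvd_natAbs.2 h3
      simpa [Int.natAbs_mul, Int.natAbs_pow] using this
    have hcard : ((T (d, e)).card : ℝ) ≤ 2 * (27 : ℕ) * M / (d.lcm e : ℕ) + 1 := by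
      refine card_le_of_dvd_mul_sub (by norm_num) (Nat.lcm_pos hd0 he0) hM
        (fun x hx => hS x (Finset.mem_filter.1 hx).1) ?_
      intro x hx y hy
      obtain ⟨-, hxd, hxe⟩ := Finset.mem_filter.1 hx
      obtain ⟨-, hyd, hye⟩ := Finset.mem_filter.1 hy
      simp only at hxd hxe hyd hye
      have h1 : (d : ℤ) ∣ 27 * (x - y) :=
        (dvd_sub hxd hyd).trans
          (dvd_of_eq (by ring))
      have h2 : (e : ℤ) ∣ 27 * (x - y) :=
        (dvd_sub hxe hye).trans
          (dvd_of_eq (by ring))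
      exact Int.natCast_dvd.2 (Nat.lcm_dvd (Int.natCast_dvd.1 h1) (Int.natCast_dvd.1 h2))
    have hlcm : 1 / ((d.lcm e : ℕ) : ℝ) = (d.gcd e : ℕ) / (l : ℝ) ^ 2 := by
      have h1 : ((d.gcd e : ℕ) : ℝ) * (d.lcm e : ℕ) = (l : ℝ) ^ 2 := by
        exact_mod_cast (Nat.gcd_mul_lcm d e).trans hde
      have h2 : ((d.lcm e : ℕ) : ℝ) ≠ 0 := by
        exact_mod_cast (Nat.lcm_pos hd0 he0).ne'
      rw [div_eq_div_iff h2 (by positivity), one_mul, h1]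
    have hle : ((d.gcd e : ℕ) : ℝ) / (l : ℝ) ^ 2 ≤ D := by
      refine Finset.single_le_sum (f := fun g : ℕ => (g : ℝ) / (l : ℝ) ^ 2)
        (fun _ _ => by positivity) ?_
      rw [Finset.mem_filter, Nat.mem_divisors]
      exact ⟨⟨hgA, by positivity⟩, hgl⟩
    calc ((T (d, e)).card : ℝ) ≤ _ := hcard
      _ = 1 + 54 * M * (1 / ((d.lcm e : ℕ) : ℝ)) := by push_cast; ring
      _ ≤ _ := by rw [hlcm]; gcongr
  calc (S.card : ℝ) ≤ (((l ^ 2).divisorsAntidiagonal.biUnion T).card : ℝ) := by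
        exact_mod_cast Finset.card_le_card hcover
    _ ≤ ∑ p ∈ (l ^ 2).divisorsAntidiagonal, ((T p).card : ℝ) := by
        exact_mod_cast Finset.card_biUnion_le
    _ ≤ ∑ p ∈ (l ^ 2).divisorsAntidiagonal, (1 + 54 * M * D) := Finset.sum_le_sum hT
    _ = _ := by
        rw [Finset.sum_const, nsmul_eq_mul, ← Nat.map_div_right_divisors, Finset.card_map]

/-- Summing `d / ℓ²` over `Y < ℓ ≤ K` and over those `d ∈ G` dividing `ℓ`. -/
theorem sum_sum_dvd_div_sq_le (G : Finset ℕ) {K : ℕ} {Y : ℝ} (hY : 0 < Y) :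
    ∑ l ∈ Finset.Icc 1 K with Y < ((l : ℕ) : ℝ), ∑ d ∈ G with d ∣ l, (d : ℝ) / (l : ℝ) ^ 2 ≤
      G.card * ((1 + Real.log K) / Y) := by
  simp_rw [Finset.sum_filter (s := G)]
  rw [Finset.sum_comm]
  rw [← nsmul_eq_mul]
  refine Finset.sum_le_card_nsmul _ _ _ fun d _ => ?_
  rw [← Finset.sum_filter, Finset.filter_filter]
  set L : Finset ℕ := {l ∈ Finset.Icc 1 K | Y < ((l : ℕ) : ℝ) ∧ d ∣ l} with hL
  have hmem : ∀ l ∈ L, 0 < l ∧ l ≤ K ∧ Y < (l : ℝ) ∧ d ∣ l ∧ 0 < d := by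
    intro l hl
    simp only [hL, Finset.mem_filter, Finset.mem_Icc] at hl
    exact ⟨hl.1.1, hl.1.2, hl.2.1, hl.2.2, Nat.pos_of_dvd_of_pos hl.2.2 hl.1.1⟩
  have hinj : Set.InjOn (fun l => l / d) (L : Set ℕ) := by
    intro x hx y hy hxy
    exact Nat.div_left_inj (hmem x hx).2.2.2.1 (hmem y hy).2.2.2.1 |>.1 hxy
  calc ∑ l ∈ L, (d : ℝ) / (l : ℝ) ^ 2 ≤ ∑ l ∈ L, (1 / ((l / d : ℕ) : ℝ)) / Y := by
        refine Finset.sum_le_sum fun l hl => ?_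
        obtain ⟨h1, -, h3, h4, h5⟩ := hmem l hl
        have h1' : (0 : ℝ) < l := by exact_mod_cast h1
        rw [Nat.cast_div h4 (by positivity), one_div_div, sq, ← div_div]
        gcongr
    _ = (∑ k ∈ L.image (fun l => l / d), 1 / (k : ℝ)) / Y := by
        rw [Finset.sum_image hinj, Finset.sum_div]
    _ ≤ (∑ k ∈ Finset.Icc 1 K, 1 / (k : ℝ)) / Y := by
        gcongr
        intro k hk
        obtain ⟨l, hl, rfl⟩ := Finset.mem_image.1 hk
        obtain ⟨h1, h2, -, h4, h5⟩ := hmem l hl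
        exact Finset.mem_Icc.2 ⟨Nat.div_pos (Nat.le_of_dvd h1 h4) h5, (Nat.div_le_self l d).trans h2⟩
    _ ≤ (1 + Real.log K) / Y := by
        gcongr
        have := harmonic_le_one_add_log K
        rw [harmonic_eq_sum_Icc] at this
        push_cast at this
        simpa only [one_div] using this

/-- `Eset2 δ X` injects into a finite set of triples `((A, ℓ), B)`. -/
theorem card_Eset2_le_sum {δ X : ℝ} (hX : 1 ≤ X) :
    (Nat.card {t : ℤ × ℤ × ℤ × ℤ // t ∈ Eset2 δ X} : ℝ) ≤
      ∑ A ∈ (Finset.Icc (-(⌊X ^ ((1 : ℝ) / 3)⌋₊ : ℤ)) ⌊X ^ ((1 : ℝ) / 3)⌋₊).erase 0,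
        ∑ l ∈ Finset.Icc 1 ⌊X ^ ((1 : ℝ) / 3)⌋₊ with X ^ δ < ((l : ℕ) : ℝ),
          (((Finset.Icc (-(⌊X ^ ((1 : ℝ) / 2)⌋₊ : ℤ)) ⌊X ^ ((1 : ℝ) / 2)⌋₊).filter
            (fun B => ((l : ℤ) ^ 2) ∣ 4 * A ^ 3 + 27 * B ^ 2)).card : ℝ) := by
  have hX0 : 0 ≤ X := by linarith
  set K := ⌊X ^ ((1 : ℝ) / 3)⌋₊ with hK
  set M := ⌊X ^ ((1 : ℝ) / 2)⌋₊ with hM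
  set R := (Finset.Icc (-(K : ℤ)) K).erase 0 with hR
  set L := {l ∈ Finset.Icc 1 K | X ^ δ < ((l : ℕ) : ℝ)} with hL
  let S : ℤ × ℕ → Finset ℤ := fun p =>
    (Finset.Icc (-(M : ℤ)) M).filter (fun B => ((p.2 : ℤ) ^ 2) ∣ 4 * p.1 ^ 3 + 27 * B ^ 2)
  let T : Finset (Σ _ : ℤ × ℕ, ℤ) := (R ×ˢ L).sigma S
  have hroot : ∀ (a : ℤ) (k : ℕ), k ≠ 0 → |(a : ℝ)| ^ k ≤ X →
      a ∈ Finset.Icc (-(⌊X ^ ((1 : ℝ) / k)⌋₊ : ℤ)) ⌊X ^ ((1 : ℝ) / k)⌋₊ := by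
    intro a k hk ha
    have h1 : ((a.natAbs : ℕ) : ℝ) ≤ X ^ ((1 : ℝ) / k) := by
      rw [Nat.cast_natAbs, Int.cast_abs, one_div]
      rw [Real.le_rpow_inv_iff_of_pos (abs_nonneg _) hX0 (by positivity), Real.rpow_natCast]
      exact ha
    have h2 := Nat.le_floor h1
    rw [Finset.mem_Icc]
    omega
  have hmem : ∀ t ∈ Eset2 δ X, (⟨(t.1, t.2.2.2.toNat), t.2.1⟩ : Σ _ : ℤ × ℕ, ℤ) ∈ T := by
    rintro ⟨A, B, m, l⟩ ⟨hE, hE1⟩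
    have hlX : (l : ℝ) ≤ X ^ ((1 : ℝ) / 3) := by
      by_contra hcon
      exact hE1 ⟨hE, not_le.1 hcon⟩
    obtain ⟨hA, -, -, hl, hAX, hBX, hlδ, heq⟩ := hE
    simp only at hA hl hAX hBX hlδ heq
    lift l to ℕ using by omega
    simp only [Int.cast_natCast] at hlX hlδ
    simp only [T, S, R, L, Finset.mem_sigma, Finset.mem_product, Finset.mem_filter,
      Finset.mem_erase, Int.toNat_natCast]
    refine ⟨⟨⟨hA, ?_⟩, Finset.mem_Icc.2 ⟨by omega, Nat.le_floor hlX⟩, hlδ⟩, ?_, ?_⟩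
    · simpa [hK] using hroot A 3 (by norm_num) (by simpa using hAX)
    · simpa [hM] using hroot B 2 (by norm_num) (by rwa [sq_abs])
    · exact ⟨m, by rw [heq, mul_comm]⟩
  have hinj : Function.Injective
      (fun t : {t : ℤ × ℤ × ℤ × ℤ // t ∈ Eset2 δ X} => (⟨_, hmem t.1 t.2⟩ : T)) := by
    rintro ⟨⟨A, B, m, l⟩, ht⟩ ⟨⟨A', B', m', l'⟩, ht'⟩ h
    obtain ⟨⟨-, -, -, hl, -, -, -, heq⟩, -⟩ := id ht
    obtain ⟨⟨-, -, -, hl', -, -, -, heq'⟩, -⟩ := id ht'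
    simp only at hl hl' heq heq'
    simp only [Subtype.mk.injEq, Sigma.mk.injEq, Prod.mk.injEq, heq_eq_eq] at h ⊢
    obtain ⟨⟨rfl, h2⟩, rfl⟩ := h
    obtain rfl : l = l' := by omega
    refine ⟨rfl, rfl, ?_, rfl⟩
    exact mul_right_cancel₀ (by positivity : l ^ 2 ≠ 0) (heq.symm.trans heq')
  have hcard : Nat.card {t : ℤ × ℤ × ℤ × ℤ // t ∈ Eset2 δ X} ≤ T.card := by
    have := Nat.card_le_card_of_injective _ hinj
    rwa [Nat.card_eq_fintype_card (α := T), Fintype.card_coe] at this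
  rw [Finset.card_sigma, Finset.sum_product] at hcard
  exact_mod_cast hcard

/-- `#𝓔_δ^{(2)}(X) ≪ X^{5/6 - δ + ε} + X^{2/3 + ε}` for fixed `δ ∈ (0, 1)` and `ε > 0`. -/
theorem Eset2_count (δ ε : ℝ) (hδ : δ ∈ Set.Ioo (0 : ℝ) 1) (hε : 0 < ε) :
    ∃ C : ℝ, 0 < C ∧ ∀ X : ℝ, 1 ≤ X →
      (Nat.card {t : ℤ × ℤ × ℤ × ℤ // t ∈ Eset2 δ X} : ℝ) ≤
        C * (X ^ (5 / 6 - δ + ε) + X ^ (2 / 3 + ε)) := by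
  set η : ℝ := ε / 3 with hη
  have hη0 : 0 < η := by positivity
  obtain ⟨C₀, hC₀, hdiv⟩ := exists_card_divisors_le_rpow hη0
  set C₁ : ℝ := C₀ * 432 ^ η with hC₁
  have hC₁0 : 0 < C₁ := by positivity
  refine ⟨2 * C₁ + 108 * C₁ ^ 2 * (1 + 1 / η), by positivity, fun X hX => ?_⟩
  have hX0 : 0 < X := by linarith
  refine (card_Eset2_le_sum hX).trans ?_
  set K := ⌊X ^ ((1 : ℝ) / 3)⌋₊ with hK
  set L := {l ∈ Finset.Icc 1 K | X ^ δ < ((l : ℕ) : ℝ)} with hL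
  have hKX : (K : ℝ) ≤ X ^ ((1 : ℝ) / 3) := Nat.floor_le (by positivity)
  have hK3 : (K : ℝ) ^ 3 ≤ X := by
    calc (K : ℝ) ^ 3 ≤ (X ^ ((1 : ℝ) / 3)) ^ 3 := by gcongr
      _ = X := by rw [← Real.rpow_natCast, ← Real.rpow_mul hX0.le]; norm_num
  have hK1 : 1 ≤ K := Nat.le_floor (by simpa using Real.one_le_rpow hX (by norm_num))
  have hlog : 1 + Real.log K ≤ (1 + 1 / η) * X ^ η := by
    have h1 : Real.log K ≤ Real.log X := by
      apply Real.log_le_log (by exact_mod_cast hK1)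
      refine le_trans ?_ hK3
      exact le_self_pow₀ (by exact_mod_cast hK1) (by norm_num)
    have h2 := Real.log_le_rpow_div hX0.le hη0
    have h3 : 1 ≤ X ^ η := Real.one_le_rpow hX hη0.le
    calc 1 + Real.log K ≤ X ^ η + X ^ η / η := by linarith
      _ = _ := by ring
  have hdivX : ∀ n : ℕ, n ≠ 0 → (n : ℝ) ≤ 432 * X → (n.divisors.card : ℝ) ≤ C₁ * X ^ η := by
    intro n hn hnX
    calc (n.divisors.card : ℝ) ≤ C₀ * (n : ℝ) ^ η := hdiv n hn
      _ ≤ C₀ * (432 * X) ^ η := by gcongr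
      _ = _ := by rw [Real.mul_rpow (by norm_num) hX0.le, hC₁]; ring
  set Q : ℝ := C₁ * X ^ η with hQ
  have hQ0 : 0 ≤ Q := by positivity
  have hM0 : (0 : ℝ) ≤ X ^ ((1 : ℝ) / 2) := by positivity
  have hY : 0 < X ^ δ := by positivity
  have hA : ∀ A ∈ (Finset.Icc (-(K : ℤ)) K).erase 0,
      (∑ l ∈ L, (((Finset.Icc (-(⌊X ^ ((1 : ℝ) / 2)⌋₊ : ℤ)) ⌊X ^ ((1 : ℝ) / 2)⌋₊).filter
            (fun B => ((l : ℤ) ^ 2) ∣ 4 * A ^ 3 + 27 * B ^ 2)).card : ℝ)) ≤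
        Q * (X ^ ((1 : ℝ) / 3) +
          54 * X ^ ((1 : ℝ) / 2) * (Q * ((1 + 1 / η) * X ^ η / X ^ δ))) := by
    intro A hA
    obtain ⟨hA0, hAK⟩ := Finset.mem_erase.1 hA
    rw [Finset.mem_Icc] at hAK
    set G := (432 * A.natAbs ^ 3).divisors with hG
    have hGcard : (G.card : ℝ) ≤ Q := by
      apply hdivX _ (by positivity)
      have h1 : ((A.natAbs : ℕ) : ℝ) ≤ K := by
        have : A.natAbs ≤ K := by omega
        exact_mod_cast this
      push_cast
      have h2 : ((A.natAbs : ℕ) : ℝ) ^ 3 ≤ (K : ℝ) ^ 3 := by gcongr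
      linarith
    calc _ ≤ ∑ l ∈ L, Q * (1 + 54 * X ^ ((1 : ℝ) / 2) *
            ∑ d ∈ G with d ∣ l, (d : ℝ) / (l : ℝ) ^ 2) := by
          refine Finset.sum_le_sum fun l hl => ?_
          obtain ⟨hlK, -⟩ := Finset.mem_filter.1 hl
          rw [Finset.mem_Icc] at hlK
          refine (card_sq_dvd_le hA0 (by omega : 0 < l) hM0 ?_ ?_).trans ?_
          · intro B hB
            have hB' := Finset.mem_Icc.1 (Finset.mem_filter.1 hB).1
            have h1 : B.natAbs ≤ ⌊X ^ ((1 : ℝ) / 2)⌋₊ := by omega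
            have h2 := (Nat.le_floor_iff hM0).1 h1
            rwa [Nat.cast_natAbs, Int.cast_abs] at h2
          · exact fun B hB => (Finset.mem_filter.1 hB).2
          · have h0 : 0 ≤ ∑ d ∈ G with d ∣ l, (d : ℝ) / (l : ℝ) ^ 2 :=
              Finset.sum_nonneg fun _ _ => by positivity
            gcongr
            have hl0 : l ≠ 0 := by omega
            apply hdivX _ (by positivity)
            have h1 : (1 : ℝ) ≤ l := by exact_mod_cast hlK.1
            have h2 : (l : ℝ) ≤ K := by exact_mod_cast hlK.2
            calc ((l ^ 2 : ℕ) : ℝ) = (l : ℝ) ^ 2 := by push_cast; ring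
              _ ≤ (l : ℝ) ^ 3 := pow_le_pow_right₀ h1 (by norm_num)
              _ ≤ (K : ℝ) ^ 3 := by gcongr
              _ ≤ 432 * X := by linarith
      _ = Q * (L.card + 54 * X ^ ((1 : ℝ) / 2) *
            ∑ l ∈ L, ∑ d ∈ G with d ∣ l, (d : ℝ) / (l : ℝ) ^ 2) := by
          rw [← Finset.mul_sum, Finset.sum_add_distrib, ← Finset.mul_sum]
          simp
      _ ≤ _ := by
          gcongr
          · refine le_trans ?_ hKX
            have := Finset.card_filter_le (Finset.Icc 1 K) (fun l : ℕ => X ^ δ < (l : ℝ))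
            rw [Nat.card_Icc, Nat.add_sub_cancel] at this
            exact_mod_cast this
          · refine (sum_sum_dvd_div_sq_le G hY).trans ?_
            have hlog0 : 0 ≤ Real.log K := Real.log_natCast_nonneg K
            gcongr
  have hcardR : ((((Finset.Icc (-(K : ℤ)) K).erase 0).card : ℕ) : ℝ) ≤ 2 * X ^ ((1 : ℝ) / 3) := by
    have h1 : ((Finset.Icc (-(K : ℤ)) K).erase 0).card = 2 * K := by
      rw [Finset.card_erase_of_mem (by simp), Int.card_Icc]
      omega
    rw [h1]
    push_cast
    linarith
  have h23 : X ^ ((1 : ℝ) / 3) * X ^ ((1 : ℝ) / 3) * X ^ η ≤ X ^ (2 / 3 + ε) := by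
    rw [← Real.rpow_add hX0, ← Real.rpow_add hX0]
    exact Real.rpow_le_rpow_of_exponent_le hX (by linarith)
  have h56 : X ^ ((1 : ℝ) / 3) * X ^ ((1 : ℝ) / 2) * X ^ η * X ^ η * X ^ η / X ^ δ =
      X ^ (5 / 6 - δ + ε) := by
    rw [← Real.rpow_add hX0, ← Real.rpow_add hX0, ← Real.rpow_add hX0, ← Real.rpow_add hX0,
      ← Real.rpow_sub hX0]
    congr 1
    rw [hη]
    ring
  calc _ ≤ _ := Finset.sum_le_card_nsmul _ _ _ hA
    _ ≤ 2 * X ^ ((1 : ℝ) / 3) * (Q * (X ^ ((1 : ℝ) / 3) +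
          54 * X ^ ((1 : ℝ) / 2) * (Q * ((1 + 1 / η) * X ^ η / X ^ δ)))) := by
        rw [nsmul_eq_mul]
        gcongr
    _ = 2 * C₁ * (X ^ ((1 : ℝ) / 3) * X ^ ((1 : ℝ) / 3) * X ^ η) +
          108 * C₁ ^ 2 * (1 + 1 / η) *
            (X ^ ((1 : ℝ) / 3) * X ^ ((1 : ℝ) / 2) * X ^ η * X ^ η * X ^ η / X ^ δ) := by
        rw [hQ]; ring
    _ ≤ 2 * C₁ * X ^ (2 / 3 + ε) + 108 * C₁ ^ 2 * (1 + 1 / η) * X ^ (5 / 6 - δ + ε) := by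
        rw [h56]
        gcongr
    _ ≤ _ := by
        have h1 : 0 ≤ 2 * C₁ * X ^ (5 / 6 - δ + ε) := by positivity
        have h2 : 0 ≤ 108 * C₁ ^ 2 * (1 + 1 / η) * X ^ (2 / 3 + ε) := by positivity
        linarith
end

section
/- Let δ ∈ (0,1) be fixed. For every X ≥ 1, every curve E_{A,B} ∈ 𝓕_δ(X), and every point P ∈ E_{A,B}(ℚ), one has ĥ_{E_{A,B}}(P) − (1/2)·h_x(P) ≥ −(δ/2)·log X − 3. -/
open WeierstrassCurve Filter

/-- The Weierstrass curve `y² = x³ + Ax + B` over `ℚ`. -/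
def Ecurve (A B : ℤ) : WeierstrassCurve.Affine ℚ :=
  { a₁ := 0, a₂ := 0, a₃ := 0, a₄ := (A : ℚ), a₆ := (B : ℚ) }

/-- Membership in the family 𝓕 : the discriminant condition and minimality condition. -/
def inFamily (A B : ℤ) : Prop :=
  4 * A ^ 3 + 27 * B ^ 2 ≠ 0 ∧
    ∀ p : ℕ, p.Prime → ¬((p : ℤ) ^ 4 ∣ A ∧ (p : ℤ) ^ 6 ∣ B)

/-- The height `H(E_{A,B}) = max {4|A|³, 27B²}`. -/
def Eheight (A B : ℤ) : ℤ := max (4 * |A| ^ 3) (27 * B ^ 2)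

/-- The family 𝓕(X), identified with the set of parameters `(A, B)`. -/
def FX (X : ℝ) : Set (ℤ × ℤ) :=
  {p | inFamily p.1 p.2 ∧ (Eheight p.1 p.2 : ℝ) ≤ X}

/-- The logarithmic Weil height of a rational number. -/
noncomputable def weilHeight (x : ℚ) : ℝ := Real.log (max |x.num| x.den)

/-- The height `h_x` on rational points of `E_{A,B}`. -/
noncomputable def hx {A B : ℤ} : (Ecurve A B).Point → ℝ
  | .zero => 0
  | @WeierstrassCurve.Affine.Point.some _ _ _ x _ _ => weilHeight x

/-- The canonical height `ĥ(P) = (1/2) lim_n 4⁻ⁿ h_x(2ⁿ P)`; since the limit exists, it is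
formalized as a limsup. -/
noncomputable def canHeight {A B : ℤ} (P : (Ecurve A B).Point) : ℝ :=
  (1 / 2) * Filter.limsup (fun n : ℕ => hx ((2 ^ n : ℕ) • P) / 4 ^ n) Filter.atTop

/-- `μ(E_{A,B})`, the minimal canonical height of a non-torsion rational point, valued in
`ℝ≥0∞` so that it is `∞` when there is no non-torsion point (i.e. when the rank is `0`). -/
noncomputable def muE (A B : ℤ) : ENNReal :=
  ⨅ P : {P : (Ecurve A B).Point // ¬IsOfFinAddOrder P}, ENNReal.ofReal (canHeight P.1)

/-- The family 𝓕_{≥1}(X) of curves of positive rank. -/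
noncomputable def F1X (X : ℝ) : Set (ℤ × ℤ) :=
  {p ∈ FX X | 1 ≤ Module.rank ℤ (Ecurve p.1 p.2).Point}

/-- The discriminant `Δ(E_{A,B}) = -16(4A³ + 27B²)`. -/
def discAB (A B : ℤ) : ℤ := -16 * (4 * A ^ 3 + 27 * B ^ 2)

/-- For `n ≠ 0`, `sqPart n` is the unique `ℓ ≥ 1` such that `n = m ℓ²` with `m` squarefree,
namely `∏ p, p ^ (v_p(n) / 2)`. -/
def sqPart (n : ℤ) : ℕ := n.natAbs.factorization.prod fun p e => p ^ (e / 2)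

/-- The subfamily 𝓕_δ(X). -/
def Fdelta (δ X : ℝ) : Set (ℤ × ℤ) :=
  {p ∈ FX X | X ^ (1 - δ) < |(discAB p.1 p.2 : ℝ)| ∧
    (sqPart (discAB p.1 p.2) : ℝ) ≤ 4 * X ^ δ}

section Duplication

variable {R : Type*} [CommRing R]

/-- The numerator of the duplication formula on `y² = x³ + Ax + B`, homogenized in `x = a / b`. -/
def dupNum (A B a b : R) : R :=
  a ^ 4 - 2 * A * a ^ 2 * b ^ 2 - 8 * B * a * b ^ 3 + A ^ 2 * b ^ 4

/-- The denominator of the duplication formula on `y² = x³ + Ax + B`, homogenized in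
`x = a / b`. -/
def dupDen (A B a b : R) : R :=
  4 * (a ^ 3 * b + A * a * b ^ 3 + B * b ^ 4)

theorem dupNum_dupDen_bezout_right (A B a b : R) :
    (12 * a ^ 2 * b + 16 * A * b ^ 3) * dupNum A B a b
      - (3 * a ^ 3 - 5 * A * a * b ^ 2 - 27 * B * b ^ 3) * dupDen A B a b
      = 4 * (4 * A ^ 3 + 27 * B ^ 2) * b ^ 7 := by
  unfold dupNum dupDen; ring

theorem dupNum_dupDen_bezout_left (A B a b : R) :
    (4 * (4 * A ^ 3 + 27 * B ^ 2) * a ^ 3 - 4 * A ^ 2 * B * a ^ 2 * b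
        + 4 * A * (3 * A ^ 3 + 22 * B ^ 2) * a * b ^ 2
        + 12 * B * (A ^ 3 + 8 * B ^ 2) * b ^ 3) * dupNum A B a b
      + (A ^ 2 * B * a ^ 3 + A * (5 * A ^ 3 + 32 * B ^ 2) * a ^ 2 * b
        + 2 * B * (13 * A ^ 3 + 96 * B ^ 2) * a * b ^ 2
        - 3 * A ^ 2 * (A ^ 3 + 8 * B ^ 2) * b ^ 3) * dupDen A B a b
      = 4 * (4 * A ^ 3 + 27 * B ^ 2) * a ^ 7 := by
  unfold dupNum dupDen; ring

end Duplication

theorem abs_dupNum_le {A B a b m : ℝ} (hA : |A| ≤ 1) (hB : |B| ≤ 1) (ha : |a| ≤ m)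
    (hb : |b| ≤ m) : |dupNum A B a b| ≤ 12 * m ^ 4 := by
  have hm : 0 ≤ m := (abs_nonneg a).trans ha
  calc |dupNum A B a b|
      ≤ |a| ^ 4 + 2 * |A| * |a| ^ 2 * |b| ^ 2 + 8 * |B| * |a| * |b| ^ 3 + |A| ^ 2 * |b| ^ 4 := by
        unfold dupNum
        refine (abs_add_le _ _).trans (add_le_add ((abs_sub _ _).trans
          (add_le_add ((abs_sub _ _).trans (add_le_add ?_ ?_)) ?_)) ?_) <;>
        simp [abs_mul, abs_pow]
    _ ≤ m ^ 4 + 2 * 1 * m ^ 2 * m ^ 2 + 8 * 1 * m * m ^ 3 + 1 ^ 2 * m ^ 4 := by gcongr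
    _ = 12 * m ^ 4 := by ring

theorem abs_dupDen_le {A B a b m : ℝ} (hA : |A| ≤ 1) (hB : |B| ≤ 1) (ha : |a| ≤ m)
    (hb : |b| ≤ m) : |dupDen A B a b| ≤ 12 * m ^ 4 := by
  have hm : 0 ≤ m := (abs_nonneg a).trans ha
  calc |dupDen A B a b|
      ≤ 4 * (|a| ^ 3 * |b| + |A| * |a| * |b| ^ 3 + |B| * |b| ^ 4) := by
        unfold dupDen
        rw [abs_mul, abs_of_pos (by norm_num : (0 : ℝ) < 4)]
        gcongr
        refine (abs_add_le _ _).trans (add_le_add ((abs_add_le _ _).trans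
          (add_le_add ?_ ?_)) ?_) <;>
        simp [abs_mul, abs_pow]
    _ ≤ 4 * (m ^ 3 * m + 1 * m * m ^ 3 + 1 * m ^ 4) := by gcongr
    _ = 12 * m ^ 4 := by ring

theorem abs_cubic_form_le {p q r s a b m : ℝ} (ha : |a| ≤ m) (hb : |b| ≤ m) :
    |p * a ^ 3 + q * a ^ 2 * b + r * a * b ^ 2 + s * b ^ 3|
      ≤ (|p| + |q| + |r| + |s|) * m ^ 3 := by
  have hm : 0 ≤ m := (abs_nonneg a).trans ha
  calc |p * a ^ 3 + q * a ^ 2 * b + r * a * b ^ 2 + s * b ^ 3|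
      ≤ |p| * |a| ^ 3 + |q| * |a| ^ 2 * |b| + |r| * |a| * |b| ^ 2 + |s| * |b| ^ 3 := by
        refine (abs_add_le _ _).trans (add_le_add ((abs_add_le _ _).trans
          (add_le_add ((abs_add_le _ _).trans (add_le_add ?_ ?_)) ?_)) ?_) <;>
        simp [abs_mul, abs_pow]
    _ ≤ |p| * m ^ 3 + |q| * m ^ 2 * m + |r| * m * m ^ 2 + |s| * m ^ 3 := by gcongr
    _ = (|p| + |q| + |r| + |s|) * m ^ 3 := by ring

theorem abs_mul_pow_le_of_bezout {f g F G D t m C : ℝ} (hC : |f| + |g| ≤ C * m ^ 3)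
    (h : f * F + g * G = D * t ^ 7) (ht : |t| = m)
    (h0 : 0 < m) :
    |D| * m ^ 4 ≤ C * max |F| |G| := by
  refine le_of_mul_le_mul_right ?_ (pow_pos h0 3)
  calc |D| * m ^ 4 * m ^ 3 = |f * F + g * G| := by rw [h, abs_mul, abs_pow, ht]; ring
    _ ≤ |f| * |F| + |g| * |G| := by simpa only [abs_mul] using abs_add_le (f * F) (g * G)
    _ ≤ |f| * max |F| |G| + |g| * max |F| |G| := by
        gcongr
        · exact le_max_left _ _
        · exact le_max_right _ _
    _ = (|f| + |g|) * max |F| |G| := by ring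
    _ ≤ C * m ^ 3 * max |F| |G| := by gcongr
    _ = C * max |F| |G| * m ^ 3 := by ring

theorem disc_mul_pow_le_max_dup {A B a b m : ℝ} (hA : |A| ≤ 1) (hB : |B| ≤ 1)
    (hm : max |a| |b| = m) (h0 : 0 < m) :
    |4 * (4 * A ^ 3 + 27 * B ^ 2)| * m ^ 4 ≤ 619 * max |dupNum A B a b| |dupDen A B a b| := by
  have ha : |a| ≤ m := hm ▸ le_max_left _ _
  have hb : |b| ≤ m := hm ▸ le_max_right _ _
  have hmono : ∀ i j : ℕ, -1 ≤ A ^ i * B ^ j ∧ A ^ i * B ^ j ≤ 1 := fun i j => by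
    rw [← abs_le, abs_mul, abs_pow, abs_pow]
    exact mul_le_one₀ (pow_le_one₀ (abs_nonneg _) hA) (by positivity)
      (pow_le_one₀ (abs_nonneg _) hB)
  rcases max_choice |a| |b| with hab | hab
  · refine abs_mul_pow_le_of_bezout ?_ (dupNum_dupDen_bezout_left A B a b) (hab.symm.trans hm) h0
    have h30 := hmono 3 0
    have h02 := hmono 0 2
    have h21 := hmono 2 1
    have h40 := hmono 4 0
    have h12 := hmono 1 2
    have h31 := hmono 3 1
    have h03 := hmono 0 3
    have h50 := hmono 5 0
    have h22 := hmono 2 2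
    have f1 : |4 * (4 * A ^ 3 + 27 * B ^ 2)| ≤ 124 := by rw [abs_le]; constructor <;> linarith
    have f2 : |-(4 * A ^ 2 * B)| ≤ 4 := by rw [abs_le]; constructor <;> linarith
    have f3 : |4 * A * (3 * A ^ 3 + 22 * B ^ 2)| ≤ 100 := by
      rw [abs_le]; constructor <;> linarith
    have f4 : |12 * B * (A ^ 3 + 8 * B ^ 2)| ≤ 108 := by rw [abs_le]; constructor <;> linarith
    have g1 : |A ^ 2 * B| ≤ 1 := by rw [abs_le]; constructor <;> linarith
    have g2 : |A * (5 * A ^ 3 + 32 * B ^ 2)| ≤ 37 := by rw [abs_le]; constructor <;> linarith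
    have g3 : |2 * B * (13 * A ^ 3 + 96 * B ^ 2)| ≤ 218 := by
      rw [abs_le]; constructor <;> linarith
    have g4 : |-(3 * A ^ 2 * (A ^ 3 + 8 * B ^ 2))| ≤ 27 := by
      rw [abs_le]; constructor <;> linarith
    have hf := abs_cubic_form_le (p := 4 * (4 * A ^ 3 + 27 * B ^ 2)) (q := -(4 * A ^ 2 * B))
      (r := 4 * A * (3 * A ^ 3 + 22 * B ^ 2)) (s := 12 * B * (A ^ 3 + 8 * B ^ 2)) ha hb
    have hg := abs_cubic_form_le (p := A ^ 2 * B) (q := A * (5 * A ^ 3 + 32 * B ^ 2))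
      (r := 2 * B * (13 * A ^ 3 + 96 * B ^ 2)) (s := -(3 * A ^ 2 * (A ^ 3 + 8 * B ^ 2))) ha hb
    have hsum := mul_le_mul_of_nonneg_right
      (add_le_add (add_le_add (add_le_add (add_le_add f1 f2) f3) f4)
        (add_le_add (add_le_add (add_le_add g1 g2) g3) g4)) (pow_pos h0 3).le
    simp only [neg_mul, ← sub_eq_add_neg] at hf hg
    linarith
  · refine abs_mul_pow_le_of_bezout ?_
      ((sub_eq_add_neg _ _).symm.trans (dupNum_dupDen_bezout_right A B a b) |> fun h => by
        rwa [← neg_mul] at h) (hab.symm.trans hm) h0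
    have f4 : |16 * A| ≤ 16 := by rw [abs_mul]; norm_num; linarith
    have g3 : |5 * A| ≤ 5 := by rw [abs_mul]; norm_num; linarith
    have g4 : |27 * B| ≤ 27 := by rw [abs_mul]; norm_num; linarith
    have hf := abs_cubic_form_le (p := 0) (q := 12) (r := 0) (s := 16 * A) ha hb
    have hg := abs_cubic_form_le (p := -3) (q := 0) (r := 5 * A) (s := 27 * B) ha hb
    have hm3 := (pow_pos h0 3).le
    have hsum := mul_le_mul_of_nonneg_right (add_le_add f4 (add_le_add g3 g4)) hm3
    have e1 : 0 * a ^ 3 + 12 * a ^ 2 * b + 0 * a * b ^ 2 + 16 * A * b ^ 3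
      = 12 * a ^ 2 * b + 16 * A * b ^ 3 := by ring
    have e2 : -3 * a ^ 3 + 0 * a ^ 2 * b + 5 * A * a * b ^ 2 + 27 * B * b ^ 3
      = -(3 * a ^ 3 - 5 * A * a * b ^ 2 - 27 * B * b ^ 3) := by ring
    rw [e1, abs_zero, abs_of_pos (by norm_num : (0 : ℝ) < 12)] at hf
    rw [e2, abs_neg 3, abs_zero, abs_of_pos (by norm_num : (0 : ℝ) < 3)] at hg
    linarith

theorem gcd_dup_eq_sq {A B a b : ℤ} (hab : IsCoprime a b)
    (hsq : IsSquare ((a ^ 3 + A * a * b ^ 2 + B * b ^ 3) * b)) :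
    ∃ s : ℕ, Int.gcd (dupNum A B a b) (dupDen A B a b) = s ^ 2 := by
  set k := a ^ 3 + A * a * b ^ 2 + B * b ^ 3 with hk
  have hkb : IsCoprime k b := by
    have : k = a ^ 3 + b * (A * a * b + B * b ^ 2) := by rw [hk]; ring
    rw [this]
    exact IsCoprime.add_mul_left_left hab.pow_left _
  have hFb : IsCoprime (dupNum A B a b) b := by
    have : dupNum A B a b = a ^ 4 + b * (-2 * A * a ^ 2 * b - 8 * B * a * b ^ 2 + A ^ 2 * b ^ 3) := by
      unfold dupNum; ring
    rw [this]
    exact IsCoprime.add_mul_left_left hab.pow_left _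
  have hF : dupNum A B a b = (3 * a ^ 2 + A * b ^ 2) ^ 2 - 2 * a * (4 * k) := by
    rw [hk]; unfold dupNum; ring
  have hG : dupDen A B a b = 4 * k * b := by rw [hk]; unfold dupDen; ring
  obtain ⟨r, hr⟩ := hsq
  obtain ⟨c, hc⟩ := Int.sq_of_isCoprime hkb (hr.trans (sq r).symm)
  have h1 : Int.gcd (dupNum A B a b) (dupDen A B a b) = Int.gcd (dupNum A B a b) (4 * k) := by
    rw [hG]
    exact Int.gcd_mul_left_right_of_gcd_eq_one (Int.isCoprime_iff_gcd_eq_one.1 hFb)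
  refine ⟨Int.gcd (3 * a ^ 2 + A * b ^ 2) (2 * c), ?_⟩
  rw [h1, hF, Int.gcd_sub_mul_right_left, ← Int.pow_gcd_pow]
  rcases hc with hc | hc <;> rw [hc]
  · congr 1; ring
  · rw [← Int.gcd_neg]; congr 1; ring

theorem gcd_dup_dvd {A B a b : ℤ} (hab : IsCoprime a b) :
    (Int.gcd (dupNum A B a b) (dupDen A B a b) : ℤ) ∣ 4 * (4 * A ^ 3 + 27 * B ^ 2) := by
  obtain ⟨u, v, huv⟩ := (hab.pow (m := 7) (n := 7))
  have hF := Int.gcd_dvd_left (dupNum A B a b) (dupDen A B a b)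
  have hG := Int.gcd_dvd_right (dupNum A B a b) (dupDen A B a b)
  have h1 := (dvd_add (hF.mul_left _) (hG.mul_left _)).trans
    (dupNum_dupDen_bezout_left A B a b).dvd
  have h2 := (dvd_sub (hF.mul_left _) (hG.mul_left _)).trans
    (dupNum_dupDen_bezout_right A B a b).dvd
  refine (dvd_add (h1.mul_left u) (h2.mul_left v)).trans (Eq.dvd ?_)
  linear_combination (4 * (4 * A ^ 3 + 27 * B ^ 2)) * huv

theorem dvd_sqPart {n : ℤ} (hn : n ≠ 0) {t : ℕ} (h : (t : ℤ) ^ 2 ∣ n) : t ∣ sqPart n := by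
  have hn' : n.natAbs ≠ 0 := Int.natAbs_ne_zero.2 hn
  have h' : t ^ 2 ∣ n.natAbs := by
    have := Int.natAbs_dvd_natAbs.2 h
    simpa [Int.natAbs_pow] using this
  have ht : t ≠ 0 := by
    rintro rfl
    exact hn' (by simpa using h')
  have hle : ∀ p, 2 * t.factorization p ≤ n.natAbs.factorization p := fun p => by
    have := (Nat.factorization_le_iff_dvd (pow_ne_zero 2 ht) hn').2 h' p
    simpa [Nat.factorization_pow] using this
  have hsub : t.factorization.support ⊆ n.natAbs.factorization.support := fun p hp => by
    rw [Finsupp.mem_support_iff] at hp ⊢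
    have := hle p
    omega
  rw [← Nat.prod_factorization_pow_eq_self ht,
    Finsupp.prod_of_support_subset _ hsub _ (fun p _ => pow_zero p)]
  exact Finset.prod_dvd_prod_of_dvd _ _ fun p _ => pow_dvd_pow p (by have := hle p; omega)

theorem le_limsup_of_quadrupling {u v : ℕ → ℝ} {K K' L : ℝ}
    (hlow : ∀ n, 4 * u n - K ≤ u (n + 1)) (hup : ∀ n, u (n + 1) ≤ 4 * u n + K')
    (hvu : ∀ n, v n ≤ u n) (huv : ∀ n, u n ≤ v n + L) :
    u 0 - K / 3 ≤ limsup (fun n => v n / 4 ^ n) atTop := by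
  have h1 : ∀ n, 4 ^ n * (u 0 - K / 3) + K / 3 ≤ u n := by
    intro n
    induction n with
    | zero => simp
    | succ n ih => have := hlow n; rw [pow_succ]; linarith
  have h2 : ∀ n, u n ≤ 4 ^ n * (u 0 + K' / 3) - K' / 3 := by
    intro n
    induction n with
    | zero => simp
    | succ n ih => have := hup n; rw [pow_succ]; linarith
  have hbdd : IsBoundedUnder (· ≤ ·) atTop (fun n => v n / 4 ^ n) := by
    refine isBoundedUnder_of ⟨u 0 + K' / 3 + |K'| / 3, fun n => ?_⟩
    rw [div_le_iff₀ (by positivity)]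
    have h4 : (1 : ℝ) ≤ 4 ^ n := one_le_pow₀ (by norm_num)
    have := mul_le_mul_of_nonneg_left h4 (abs_nonneg K')
    have := neg_abs_le K'
    linarith [hvu n, h2 n]
  have hlim : Tendsto (fun n : ℕ => u 0 - K / 3 - (L - K / 3) * (1 / 4) ^ n) atTop
      (nhds (u 0 - K / 3 - (L - K / 3) * 0)) :=
    ((tendsto_pow_atTop_nhds_zero_of_lt_one (by norm_num) (by norm_num)).const_mul _).const_sub _
  rw [mul_zero, sub_zero] at hlim
  rw [← hlim.limsup_eq]
  refine limsup_le_limsup (Eventually.of_forall fun n => ?_) hlim.isBoundedUnder_ge.isCoboundedUnder_le hbdd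
  dsimp only
  rw [le_div_iff₀ (by positivity), sub_mul, mul_assoc, ← mul_pow]
  norm_num
  linarith [h1 n, huv n]

theorem Int.gcd_eq_natAbs_of_eq_mul_num_den {F G c : ℤ} {q : ℚ} (hF : F = c * q.num)
    (hG : G = c * q.den) : Int.gcd F G = c.natAbs := by
  rw [hF, hG, Int.gcd_mul_left, Int.gcd_eq_natAbs_gcd_natAbs, Int.natAbs_natCast,
    q.reduced.gcd_eq_one, mul_one]

section Doubling

variable {A B : ℤ} {x y : ℚ}

theorem Ecurve_equation (h : (Ecurve A B).Equation x y) : y ^ 2 = x ^ 3 + A * x + B := by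
  simpa [Ecurve, WeierstrassCurve.Affine.equation_iff] using h

theorem Ecurve_negY : (Ecurve A B).negY x y = -y := by
  simp [Ecurve, WeierstrassCurve.Affine.negY]

theorem isSquare_of_equation (h : y ^ 2 = x ^ 3 + A * x + B) :
    IsSquare ((x.num ^ 3 + A * x.num * (x.den : ℤ) ^ 2 + B * (x.den : ℤ) ^ 3) * (x.den : ℤ)) := by
  rw [← Rat.isSquare_intCast_iff]
  refine ⟨y * x.den ^ 2, ?_⟩
  push_cast
  rw [← Rat.mul_den_eq_num x]
  linear_combination (-(x.den : ℚ) ^ 4) * h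

theorem dupDen_num_den (h : y ^ 2 = x ^ 3 + A * x + B) :
    ((dupDen A B x.num x.den : ℤ) : ℚ) = 4 * x.den ^ 4 * y ^ 2 := by
  unfold dupDen
  push_cast
  rw [← Rat.mul_den_eq_num x]
  linear_combination (-4 * (x.den : ℚ) ^ 4) * h

theorem dupNum_num_den :
    ((dupNum A B x.num x.den : ℤ) : ℚ) = x.den ^ 4 * dupNum (A : ℚ) B x 1 := by
  unfold dupNum
  push_cast
  rw [← Rat.mul_den_eq_num x]
  ring

theorem Ecurve_addX_slope_self (h : y ^ 2 = x ^ 3 + A * x + B) (hy : y ≠ 0) :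
    (Ecurve A B).addX x x ((Ecurve A B).slope x x y y)
      = ((dupNum A B x.num x.den : ℤ) : ℚ) / ((dupDen A B x.num x.den : ℤ) : ℚ) := by
  have hne : y ≠ (Ecurve A B).negY x y := by
    rw [Ecurve_negY]
    intro h'
    exact hy (by linarith)
  have hd : (x.den : ℚ) ≠ 0 := by simp
  rw [WeierstrassCurve.Affine.slope_of_Y_ne rfl hne, dupDen_num_den h, dupNum_num_den, Ecurve_negY]
  simp only [WeierstrassCurve.Affine.addX, Ecurve]
  unfold dupNum
  rw [mul_comm (4 : ℚ), mul_assoc ((x.den : ℚ) ^ 4), mul_div_mul_left _ _ (pow_ne_zero 4 hd)]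
  have h2 : y - -y = 2 * y := by ring
  rw [h2]
  field_simp
  linear_combination (-32 * x) * h

end Doubling

/-- The height on `E_{A,B}(ℚ)` in which the denominator of `x` is scaled by `T`. -/
noncomputable def scaledHeight (T : ℝ) {A B : ℤ} : (Ecurve A B).Point → ℝ
  | .zero => 0
  | @WeierstrassCurve.Affine.Point.some _ _ _ x _ _ => Real.log (max |(x.num : ℝ)| (T * x.den))

section ScaledHeight

variable {A B : ℤ} {T : ℝ}

theorem one_le_max_num_den (x : ℚ) : (1 : ℝ) ≤ max |(x.num : ℝ)| x.den :=
  le_max_of_le_right (by exact_mod_cast x.pos)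

theorem hx_le_scaledHeight (hT : 1 ≤ T) (P : (Ecurve A B).Point) : hx P ≤ scaledHeight T P := by
  rcases P with _ | ⟨x, y, h⟩
  · exact le_rfl
  · have := one_le_max_num_den x
    simp only [hx, weilHeight, scaledHeight]
    refine Real.log_le_log (by linarith) (max_le_max le_rfl ?_)
    exact le_mul_of_one_le_left (by positivity) hT

theorem scaledHeight_le_hx_add (hT : 1 ≤ T) (P : (Ecurve A B).Point) :
    scaledHeight T P ≤ hx P + Real.log T := by
  rcases P with _ | ⟨x, y, h⟩
  · simpa [hx, scaledHeight] using Real.log_nonneg hT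
  · have := one_le_max_num_den x
    simp only [hx, weilHeight, scaledHeight]
    rw [← Real.log_mul (by linarith) (by linarith)]
    refine Real.log_le_log (lt_max_of_lt_right (by positivity)) (max_le ?_ ?_)
    · exact (le_max_left _ _).trans (le_mul_of_one_le_right (by linarith) hT)
    · rw [mul_comm]
      gcongr
      exact le_max_right _ _

theorem exists_scaledHeight_two_nsmul {x y : ℚ} (h : (Ecurve A B).Nonsingular x y) :
    ∃ r : ℝ, scaledHeight T (2 • WeierstrassCurve.Affine.Point.some x y h) = Real.log r ∧
      r * Int.gcd (dupNum A B x.num x.den) (dupDen A B x.num x.den)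
        = max |((dupNum A B x.num x.den : ℤ) : ℝ)| (T * |((dupDen A B x.num x.den : ℤ) : ℝ)|) := by
  have heq := Ecurve_equation h.1
  have hG := dupDen_num_den heq
  rw [two_nsmul]
  by_cases hy : y = 0
  · have h0 : dupDen A B x.num x.den = 0 := by
      rw [hy] at hG
      exact_mod_cast hG.trans (by ring : _ = (0 : ℚ))
    refine ⟨1, ?_, ?_⟩
    · rw [WeierstrassCurve.Affine.Point.add_self_of_Y_eq (by rw [Ecurve_negY, hy, neg_zero]),
        Real.log_one]
      rfl
    · rw [h0]
      simp
  · have hne : y ≠ (Ecurve A B).negY x y := by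
      rw [Ecurve_negY]
      intro h'
      exact hy (by linarith)
    have hG0 : dupDen A B x.num x.den ≠ 0 := by
      intro h0
      rw [h0, Int.cast_zero] at hG
      have : (x.den : ℚ) ≠ 0 := by simp
      exact (by positivity : (4 * (x.den : ℚ) ^ 4 * y ^ 2) ≠ 0) hG.symm
    set q := (Ecurve A B).addX x x ((Ecurve A B).slope x x y y) with hq
    have hqF := hq.trans (Ecurve_addX_slope_self heq hy)
    rw [← Rat.divInt_eq_div] at hqF
    obtain ⟨c, hc1, hc2⟩ := Rat.num_den_mk hG0 hqF
    refine ⟨max |(q.num : ℝ)| (T * q.den), ?_, ?_⟩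
    · rw [WeierstrassCurve.Affine.Point.add_self_of_Y_ne hne]
      rfl
    · rw [Int.gcd_eq_natAbs_of_eq_mul_num_den hc1 hc2, hc1, hc2]
      rw [Nat.cast_natAbs, Int.cast_abs, max_mul_of_nonneg _ _ (abs_nonneg _)]
      push_cast
      rw [abs_mul, abs_mul, Nat.abs_cast]
      congr 1 <;> ring

theorem scaledHeight_two_nsmul_bounds {Y : ℝ} (hT : 1 ≤ T) (hA : |(A : ℝ)| ≤ T ^ 2)
    (hB : |(B : ℝ)| ≤ T ^ 3) (hY : 1 ≤ Y) (hΔ : discAB A B ≠ 0)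
    (hTΔ : T ^ 6 ≤ |(discAB A B : ℝ)| * Y) (hsq : (sqPart (discAB A B) : ℝ) ≤ 4 * Y)
    (P : (Ecurve A B).Point) :
    4 * scaledHeight T P - Real.log (9904 * Y ^ 3) ≤ scaledHeight T (2 • P) ∧
      scaledHeight T (2 • P) ≤ 4 * scaledHeight T P + Real.log 12 := by
  have hT0 : 0 < T := by linarith
  rcases P with _ | ⟨x, y, h⟩
  · have h2 : (2 • WeierstrassCurve.Affine.Point.zero : (Ecurve A B).Point) = .zero :=
      nsmul_zero 2
    have hY3 : 1 ≤ Y ^ 3 := one_le_pow₀ hY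
    rw [h2]
    simp only [scaledHeight, mul_zero, zero_sub, zero_add]
    exact ⟨neg_nonpos.2 (Real.log_nonneg (by linarith)), Real.log_nonneg (by norm_num)⟩
  obtain ⟨r, hr, hrD⟩ := exists_scaledHeight_two_nsmul (T := T) h
  have hab : IsCoprime x.num (x.den : ℤ) := by
    rw [Int.isCoprime_iff_gcd_eq_one]
    exact x.reduced
  obtain ⟨s, hs⟩ := gcd_dup_eq_sq hab (isSquare_of_equation (Ecurve_equation h.1))
  have hdvd := gcd_dup_dvd (A := A) (B := B) hab
  rw [hs] at hrD hdvd
  have hsY : (s : ℝ) ≤ 2 * Y := by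
    have h1 : 2 * s ∣ sqPart (discAB A B) := by
      refine dvd_sqPart hΔ ?_
      obtain ⟨k, hk⟩ := hdvd
      refine ⟨-k, ?_⟩
      push_cast at hk ⊢
      unfold discAB
      linear_combination (-4) * hk
    have h2 : sqPart (discAB A B) ≠ 0 := Finset.prod_ne_zero_iff.2 fun p hp =>
      pow_ne_zero _ (Nat.prime_of_mem_primeFactors hp).ne_zero
    have h3 : ((2 * s : ℕ) : ℝ) ≤ sqPart (discAB A B) :=
      Nat.cast_le.2 (Nat.le_of_dvd (Nat.pos_of_ne_zero h2) h1)
    push_cast at h3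
    linarith
  set a : ℝ := (x.num : ℝ) with ha
  set d : ℝ := (x.den : ℝ) with hd
  have hd0 : 0 < d := by rw [hd]; exact_mod_cast x.pos
  set m := max |a| (T * d) with hm
  have hm0 : 0 < m := lt_max_of_lt_right (by positivity)
  have hm' : max |a| |T * d| = m := by rw [abs_of_pos (by positivity : 0 < T * d)]
  have hF : ((dupNum A B x.num x.den : ℤ) : ℝ) = dupNum (A / T ^ 2) (B / T ^ 3) a (T * d) := by
    rw [ha, hd]
    unfold dupNum
    push_cast
    field_simp
  have hG : T * |((dupDen A B x.num x.den : ℤ) : ℝ)|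
      = |dupDen (A / T ^ 2) (B / T ^ 3) a (T * d)| := by
    rw [← abs_of_pos hT0, ← abs_mul, abs_of_pos hT0, ha, hd]
    unfold dupDen
    push_cast
    congr 1
    field_simp
  have hA' : |(A : ℝ) / T ^ 2| ≤ 1 := by
    rw [abs_div, abs_of_pos (by positivity : 0 < T ^ 2)]
    exact div_le_one_of_le₀ hA (by positivity)
  have hB' : |(B : ℝ) / T ^ 3| ≤ 1 := by
    rw [abs_div, abs_of_pos (by positivity : 0 < T ^ 3)]
    exact div_le_one_of_le₀ hB (by positivity)
  rw [hF, hG] at hrD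
  have hlow := disc_mul_pow_le_max_dup hA' hB' hm' hm0
  have hup : max |dupNum (A / T ^ 2) (B / T ^ 3) a (T * d)|
      |dupDen (A / T ^ 2) (B / T ^ 3) a (T * d)| ≤ 12 * m ^ 4 :=
    max_le (abs_dupNum_le hA' hB' (hm' ▸ le_max_left _ _) (hm' ▸ le_max_right _ _))
      (abs_dupDen_le hA' hB' (hm' ▸ le_max_left _ _) (hm' ▸ le_max_right _ _))
  have hdisc : |4 * (4 * ((A : ℝ) / T ^ 2) ^ 3 + 27 * ((B : ℝ) / T ^ 3) ^ 2)|
      = |(discAB A B : ℝ)| / (4 * T ^ 6) := by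
    have h4 : 0 < 4 * T ^ 6 := by positivity
    rw [← abs_of_pos h4, ← abs_div, ← abs_neg]
    congr 1
    unfold discAB
    push_cast
    field_simp
    ring
  rw [hdisc, ← hrD] at hlow
  rw [← hrD] at hup
  have hdiscY : 1 ≤ |(discAB A B : ℝ)| / (4 * T ^ 6) * (4 * Y) := by
    rw [div_mul_eq_mul_div, le_div_iff₀ (by positivity)]
    linarith
  have hm4 : 0 < m ^ 4 := by positivity
  have hlow' : m ^ 4 ≤ 2476 * Y * (r * (s ^ 2 : ℕ)) := by
    have h1 := mul_le_mul_of_nonneg_right hdiscY hm4.le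
    have h2 := mul_le_mul_of_nonneg_right hlow (by positivity : 0 ≤ 4 * Y)
    linarith
  have hs0 : s ≠ 0 := by
    rintro rfl
    norm_num at hlow'
    linarith
  have hs1 : (1 : ℝ) ≤ (s ^ 2 : ℕ) := by exact_mod_cast Nat.one_le_pow _ _ (Nat.pos_of_ne_zero hs0)
  have hs4 : ((s ^ 2 : ℕ) : ℝ) ≤ 4 * Y ^ 2 := by
    push_cast
    calc (s : ℝ) ^ 2 ≤ (2 * Y) ^ 2 := by gcongr
      _ = 4 * Y ^ 2 := by ring
  have hr0 : 0 < r := by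
    by_contra! hr0
    have : r * (s ^ 2 : ℕ) ≤ 0 := mul_nonpos_of_nonpos_of_nonneg hr0 (by positivity)
    have := mul_nonpos_of_nonneg_of_nonpos (by positivity : 0 ≤ 2476 * Y) this
    linarith
  have hlow'' : m ^ 4 ≤ 9904 * Y ^ 3 * r := by
    calc m ^ 4 ≤ 2476 * Y * (r * (s ^ 2 : ℕ)) := hlow'
      _ ≤ 2476 * Y * (r * (4 * Y ^ 2)) := by gcongr
      _ = 9904 * Y ^ 3 * r := by ring
  have hup' : r ≤ 12 * m ^ 4 := (le_mul_of_one_le_right hr0.le hs1).trans hup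
  have hlogm : Real.log (m ^ 4) = 4 * Real.log m := by simp
  rw [hr]
  change 4 * Real.log m - _ ≤ _ ∧ _ ≤ 4 * Real.log m + _
  rw [← hlogm]
  constructor
  · rw [sub_le_iff_le_add', ← Real.log_mul (by positivity) hr0.ne']
    exact Real.log_le_log hm4 hlow''
  · rw [add_comm, ← Real.log_mul (by norm_num) hm4.ne']
    exact Real.log_le_log hr0 hup'

end ScaledHeight

theorem log_9904_le : Real.log 9904 ≤ 18 := by
  rw [Real.log_le_iff_le_exp (by norm_num)]
  calc (9904 : ℝ) ≤ 2 ^ 18 := by norm_num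
    _ ≤ Real.exp 1 ^ 18 := by
        gcongr
        linarith [Real.add_one_le_exp 1]
    _ = Real.exp 18 := by rw [← Real.exp_nat_mul]; norm_num

/-- For any `E_{A,B} ∈ 𝓕_δ(X)` and any rational point `P`, one has
`ĥ(P) - (1/2) h_x(P) ≥ -(δ/2) log X - 3`. -/
theorem canHeight_sub_half_hx_lower_bound (δ : ℝ) (hδ : δ ∈ Set.Ioo (0 : ℝ) 1)
    (X : ℝ) (hX : 1 ≤ X) (A B : ℤ) (hAB : (A, B) ∈ Fdelta δ X)
    (P : (Ecurve A B).Point) :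
    canHeight P - (1 / 2) * hx P ≥ -(δ / 2) * Real.log X - 3 := by
  obtain ⟨⟨⟨hne, -⟩, hH⟩, hΔX, hsq⟩ := hAB
  dsimp only at hne hH hΔX hsq
  have hX0 : 0 < X := by linarith
  have hΔ : discAB A B ≠ 0 := mul_ne_zero (by norm_num) hne
  set T : ℝ := X ^ (1 / 6 : ℝ) with hTdef
  have hT : 1 ≤ T := Real.one_le_rpow hX (by norm_num)
  have hT6 : T ^ 6 = X := by
    rw [hTdef, ← Real.rpow_natCast, ← Real.rpow_mul hX0.le]
    norm_num
  have hY : 1 ≤ X ^ δ := Real.one_le_rpow hX hδ.1.le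
  rw [Eheight, Int.cast_max, max_le_iff] at hH
  push_cast at hH
  have hA : |(A : ℝ)| ≤ T ^ 2 := by
    refine le_of_pow_le_pow_left₀ (n := 3) (by norm_num) (by positivity) ?_
    rw [← pow_mul, hT6]
    have : 0 ≤ |(A : ℝ)| ^ 3 := by positivity
    linarith [hH.1]
  have hB : |(B : ℝ)| ≤ T ^ 3 := by
    refine le_of_pow_le_pow_left₀ (n := 2) (by norm_num) (by positivity) ?_
    rw [← pow_mul, hT6, sq_abs]
    linarith [hH.2, sq_nonneg (B : ℝ)]
  have hTΔ : T ^ 6 ≤ |(discAB A B : ℝ)| * X ^ δ := by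
    calc T ^ 6 = X ^ (1 - δ) * X ^ δ := by
          rw [hT6, ← Real.rpow_add hX0, sub_add_cancel, Real.rpow_one]
      _ ≤ |(discAB A B : ℝ)| * X ^ δ := by gcongr
  have hstep := scaledHeight_two_nsmul_bounds hT hA hB hY hΔ hTΔ hsq
  have hsucc : ∀ n : ℕ, (2 ^ (n + 1) : ℕ) • P = 2 • ((2 ^ n : ℕ) • P) := fun n => by
    rw [pow_succ', mul_smul]
  have hlim := le_limsup_of_quadrupling (u := fun n => scaledHeight T ((2 ^ n : ℕ) • P))
    (v := fun n => hx ((2 ^ n : ℕ) • P))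
    (fun n => by simpa only [hsucc] using (hstep _).1)
    (fun n => by simpa only [hsucc] using (hstep _).2)
    (fun n => hx_le_scaledHeight hT _) (fun n => scaledHeight_le_hx_add hT _)
  have hlog : Real.log (9904 * (X ^ δ) ^ 3) = Real.log 9904 + 3 * (δ * Real.log X) := by
    rw [Real.log_mul (by norm_num) (by positivity), Real.log_pow, Real.log_rpow hX0]
    norm_num
  simp only [pow_zero, one_smul] at hlim
  rw [hlog] at hlim
  have := hx_le_scaledHeight hT P
  have := log_9904_le
  unfold canHeight
  linarith
end

section
/- Let ε > 0 be fixed. For all U, V ≥ 1 and all q ∈ ℤ_{≥1}, one has ℳ(U,V,q) ≪ (UVq)^ε · (UV/q⁴ + V/q² + U^{3/4}V^{1/2}/q² + q²U/V + q²/U^{1/2}), with implied constant depending only on ε. -/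
/-- `ℳ(U, V, q)`: the number of `(u, v) ∈ ℤ²` with `v² ≡ u³ (mod q⁴)`, `|u| ≤ U`, `|v| ≤ V` and
`gcd(uv, q) = 1`. -/
noncomputable def Mcount (U V : ℝ) (q : ℤ) : ℕ :=
  Nat.card {t : ℤ × ℤ // t.2 ^ 2 ≡ t.1 ^ 3 [ZMOD q ^ 4] ∧
    (|t.1| : ℝ) ≤ U ∧ (|t.2| : ℝ) ≤ V ∧ Int.gcd (t.1 * t.2) q = 1}

/-- A finite set of integers of diameter at most `L` whose points are `δ`-separated has at most
`L / δ + 1` elements. -/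
theorem card_le_of_separated (S : Finset ℤ) {δ L : ℝ} (hδ : 0 < δ) (hL : 0 ≤ L)
    (hsep : ∀ x ∈ S, ∀ y ∈ S, x < y → δ ≤ (y : ℝ) - x)
    (hdiam : ∀ x ∈ S, ∀ y ∈ S, (y : ℝ) - x ≤ L) :
    (S.card : ℝ) ≤ L / δ + 1 := by
  rcases S.eq_empty_or_nonempty with rfl | hS
  · simp only [Finset.card_empty, Nat.cast_zero]; positivity
  set m := S.min' hS with hm
  have hmS : m ∈ S := S.min'_mem hS
  have hnn : ∀ x ∈ S, 0 ≤ ((x : ℝ) - m) / δ := fun x hx ↦ by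
    have : (m : ℝ) ≤ x := by exact_mod_cast S.min'_le x hx
    exact div_nonneg (by linarith) hδ.le
  have hcard : S.card ≤ (Finset.range (⌊L / δ⌋₊ + 1)).card := by
    refine Finset.card_le_card_of_injOn (fun x ↦ ⌊((x : ℝ) - m) / δ⌋₊) ?_ ?_
    · intro x hx
      simp only [Finset.coe_range, Set.mem_Iio]
      refine Nat.lt_succ_of_le (Nat.floor_le_floor ?_)
      gcongr
      exact hdiam m hmS x hx
    · have key : ∀ x ∈ S, ∀ y ∈ S, x < y →
          ⌊((x : ℝ) - m) / δ⌋₊ ≠ ⌊((y : ℝ) - m) / δ⌋₊ := by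
        intro x hx y hy hxy
        refine ne_of_lt (Nat.lt_of_succ_le (Nat.le_floor ?_))
        have h1 := Nat.floor_le (hnn x hx)
        have h2 : 1 ≤ ((y : ℝ) - x) / δ := by
          rw [le_div_iff₀ hδ]; linarith [hsep x hx y hy hxy]
        have h3 : ((y : ℝ) - m) / δ = ((x : ℝ) - m) / δ + ((y : ℝ) - x) / δ := by ring
        push_cast
        linarith
      intro x hx y hy hxy
      rcases lt_trichotomy x y with h | h | h
      · exact absurd hxy (key x hx y hy h)
      · exact h
      · exact absurd hxy.symm (key y hy x hx h)
  rw [Finset.card_range] at hcard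
  calc (S.card : ℝ) ≤ ((⌊L / δ⌋₊ + 1 : ℕ) : ℝ) := by exact_mod_cast hcard
    _ ≤ L / δ + 1 := by
      push_cast
      linarith [Nat.floor_le (div_nonneg hL hδ.le)]

/-- If every fibre of `f` on `S` has at most `c` elements, and the image lies in `T`, then
`#S ≤ c * #T`. -/
theorem card_le_mul_card_of_fiber_le {α β : Type*} [DecidableEq β] (S : Finset α)
    (T : Finset β) (f : α → β) (hf : ∀ x ∈ S, f x ∈ T) {c : ℝ}
    (hc : ∀ y ∈ T, ((S.filter fun x ↦ f x = y).card : ℝ) ≤ c) :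
    (S.card : ℝ) ≤ c * T.card := by
  rw [Finset.card_eq_sum_card_fiberwise (f := f) (t := T) hf]
  push_cast
  calc ∑ y ∈ T, ((S.filter fun x ↦ f x = y).card : ℝ) ≤ ∑ _y ∈ T, c := Finset.sum_le_sum hc
    _ = c * T.card := by rw [Finset.sum_const, nsmul_eq_mul, mul_comm]

theorem sum_inv_sqrt_le (J : ℕ) : ∑ j ∈ Finset.Icc 1 J, 1 / √(j : ℝ) ≤ 2 * √(J : ℝ) := by
  induction J with
  | zero => simp
  | succ n ih =>
    rw [Finset.sum_Icc_succ_top (by omega)]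
    have ha : 0 ≤ √(n : ℝ) := Real.sqrt_nonneg _
    have hb : 0 < √((n + 1 : ℕ) : ℝ) := Real.sqrt_pos.mpr (by positivity)
    have hab : √((n + 1 : ℕ) : ℝ) ^ 2 = √(n : ℝ) ^ 2 + 1 := by
      rw [Real.sq_sqrt (by positivity), Real.sq_sqrt (by positivity)]; push_cast; ring
    have : 1 / √((n + 1 : ℕ) : ℝ) ≤ 2 * √((n + 1 : ℕ) : ℝ) - 2 * √(n : ℝ) := by
      rw [div_le_iff₀ hb]
      nlinarith [sq_nonneg (√((n + 1 : ℕ) : ℝ) - √(n : ℝ))]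
    linarith

/-- Pairs `(w, j)` with `3 w ^ 2` within `B` of `j Q ^ 2`, for large positive `w`. -/
theorem card_pairs_of_pos {Q : ℕ} (hQ : 0 < Q) (W B : ℕ) (S : Finset (ℤ × ℤ))
    (hS : ∀ p ∈ S, 0 < p.1 ∧ p.1 ≤ W ∧ |3 * p.1 ^ 2 - p.2 * Q ^ 2| ≤ (B : ℤ) ∧ (B : ℤ) < p.1 ^ 2) :
    (S.card : ℝ) ≤ 4 * W ^ 2 / Q ^ 2 + 4 * B * W / Q ^ 2 := by
  have hQr : (0 : ℝ) < Q := by exact_mod_cast hQ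
  set J : ℕ := 4 * W ^ 2 / Q ^ 2 with hJ
  have hJr : (J : ℝ) ≤ 4 * W ^ 2 / Q ^ 2 := by
    have := @Nat.cast_div_le ℝ _ _ _ (4 * W ^ 2) (Q ^ 2)
    push_cast at this
    exact this
  have hsqrtJ : √(J : ℝ) ≤ 2 * W / Q := by
    rw [Real.sqrt_le_left (by positivity)]
    refine hJr.trans (le_of_eq ?_)
    ring
  have hjpos : ∀ p ∈ S, 0 < p.2 := by
    intro p hp
    obtain ⟨h1, h2, h3, h4⟩ := hS p hp
    have h5 := (abs_le.mp h3).2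
    by_contra! h
    have : p.2 * (Q : ℤ) ^ 2 ≤ 0 := mul_nonpos_of_nonpos_of_nonneg h (by positivity)
    nlinarith
  have hmap : ∀ p ∈ S, p.2.toNat ∈ Finset.Icc 1 J := by
    intro p hp
    obtain ⟨h1, h2, h3, h4⟩ := hS p hp
    have hj := hjpos p hp
    have h5 := (abs_le.mp h3).1
    rw [Finset.mem_Icc]
    refine ⟨by omega, ?_⟩
    rw [hJ, Nat.le_div_iff_mul_le (by positivity)]
    zify
    rw [Int.toNat_of_nonneg hj.le]
    nlinarith
  rw [Finset.card_eq_sum_card_fiberwise (f := fun p : ℤ × ℤ ↦ p.2.toNat) (t := Finset.Icc 1 J) hmap]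
  push_cast
  have hfib : ∀ j ∈ Finset.Icc 1 J, ((S.filter fun p ↦ p.2.toNat = j).card : ℝ) ≤
      1 + B / Q * (1 / √(j : ℝ)) := by
    intro j hj
    have hj1 : 1 ≤ j := (Finset.mem_Icc.mp hj).1
    have hsj : 0 < √(j : ℝ) := Real.sqrt_pos.mpr (by exact_mod_cast hj1)
    set F := S.filter fun p ↦ p.2.toNat = j with hF
    have hF2 : ∀ p ∈ F, p.2 = j := fun p hp ↦ by
      have h1 := Finset.mem_filter.mp hp
      have h2 := hjpos p h1.1
      omega
    have hcard : F.card = (F.image Prod.fst).card := by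
      refine (Finset.card_image_of_injOn fun p hp p' hp' h ↦ ?_).symm
      exact Prod.ext h ((hF2 p hp).trans (hF2 p' hp').symm)
    have hmem : ∀ w ∈ F.image Prod.fst, 0 < w ∧ |3 * w ^ 2 - j * Q ^ 2| ≤ (B : ℤ) ∧ (B : ℤ) < w ^ 2 := by
      intro w hw
      obtain ⟨p, hp, rfl⟩ := Finset.mem_image.mp hw
      obtain ⟨h1, h2, h3, h4⟩ := hS p (Finset.mem_filter.mp hp).1
      rw [hF2 p hp] at h3
      exact ⟨h1, h3, h4⟩
    have hlow : ∀ w ∈ F.image Prod.fst, √(j : ℝ) * Q ≤ 2 * (w : ℝ) := by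
      intro w hw
      obtain ⟨h1, h2, h3⟩ := hmem w hw
      have h5 : (j : ℤ) * Q ^ 2 ≤ 4 * w ^ 2 := by linarith [(abs_le.mp h2).1]
      have h5r : (j : ℝ) * Q ^ 2 ≤ 4 * (w : ℝ) ^ 2 := by exact_mod_cast h5
      have h1r : (0 : ℝ) < w := by exact_mod_cast h1
      refine (sq_le_sq₀ (by positivity) (by positivity)).mp ?_
      rw [mul_pow, Real.sq_sqrt (by positivity)]
      linarith
    rw [hcard]
    have hsepr := card_le_of_separated (F.image Prod.fst) (δ := 1) (L := B / (√(j : ℝ) * Q))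
      one_pos (by positivity) (fun x _ y _ h ↦ by
        have : x + 1 ≤ y := h
        have : (x : ℝ) + 1 ≤ y := by exact_mod_cast this
        linarith) (fun x hx y hy ↦ by
        rw [le_div_iff₀ (by positivity)]
        obtain ⟨hx1, hx2, hx3⟩ := hmem x hx
        obtain ⟨hy1, hy2, hy3⟩ := hmem y hy
        have h6 : 3 * (y ^ 2 - x ^ 2) ≤ 2 * (B : ℤ) := by
          linarith [(abs_le.mp hx2).1, (abs_le.mp hy2).2]
        have h6r : 3 * ((y : ℝ) ^ 2 - (x : ℝ) ^ 2) ≤ 2 * B := by exact_mod_cast h6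
        rcases le_or_gt y x with h | h
        · have : (y : ℝ) ≤ x := by exact_mod_cast h
          have h7 : ((y : ℝ) - x) * (√(j : ℝ) * Q) ≤ 0 :=
            mul_nonpos_of_nonpos_of_nonneg (by linarith) (by positivity)
          have : (0 : ℝ) ≤ B := by positivity
          linarith
        · have : (x : ℝ) < y := by exact_mod_cast h
          have h7 := hlow x hx
          have h8 := hlow y hy
          have h9 : ((y : ℝ) - x) * (√(j : ℝ) * Q) ≤ (y - x) * (x + y) := by
            refine mul_le_mul_of_nonneg_left ?_ (by linarith)
            linarith
          have : (0 : ℝ) ≤ B := by positivity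
          nlinarith)
    refine hsepr.trans (le_of_eq ?_)
    field_simp
    ring
  calc _ ≤ ∑ j ∈ Finset.Icc 1 J, (1 + B / Q * (1 / √(j : ℝ))) := Finset.sum_le_sum hfib
    _ = J + B / Q * ∑ j ∈ Finset.Icc 1 J, 1 / √(j : ℝ) := by
      rw [Finset.sum_add_distrib, Finset.mul_sum]; simp
    _ ≤ 4 * W ^ 2 / Q ^ 2 + B / Q * (2 * (2 * W / Q)) := by
      gcongr
      exact (sum_inv_sqrt_le J).trans (by gcongr)
    _ = _ := by ring

theorem card_pairs {Q : ℕ} (hQ : 0 < Q) (W B : ℕ) (S : Finset (ℤ × ℤ))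
    (hS : ∀ p ∈ S, |p.1| ≤ W ∧ |3 * p.1 ^ 2 - p.2 * Q ^ 2| ≤ (B : ℤ)) :
    (S.card : ℝ) ≤ 1 + 2 * √(B : ℝ) + (12 * W + 2) * B / Q ^ 2 + 8 * W ^ 2 / Q ^ 2 := by
  have hQr : (0 : ℝ) < Q := by exact_mod_cast hQ
  have hone : ∀ x y : ℤ, x < y → (1 : ℝ) ≤ (y : ℝ) - x := fun x y h ↦ by
    have : x + 1 ≤ y := h
    have : (x : ℝ) + 1 ≤ y := by exact_mod_cast this
    linarith
  set S₁ := S.filter fun p ↦ p.1 ^ 2 ≤ (B : ℤ) with hS₁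
  set S₂ := S.filter fun p ↦ (B : ℤ) < p.1 ^ 2 ∧ 0 < p.1 with hS₂
  set S₃ := S.filter fun p ↦ (B : ℤ) < p.1 ^ 2 ∧ p.1 < 0 with hS₃
  have hcard : S.card ≤ S₁.card + S₂.card + S₃.card := by
    have : S ⊆ S₁ ∪ S₂ ∪ S₃ := by
      intro p hp
      simp only [hS₁, hS₂, hS₃, Finset.mem_union, Finset.mem_filter]
      rcases le_or_gt (p.1 ^ 2) (B : ℤ) with h | h
      · exact Or.inl (Or.inl ⟨hp, h⟩)
      · rcases lt_trichotomy p.1 0 with h' | h' | h'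
        · exact Or.inr ⟨hp, h, h'⟩
        · rw [h'] at h; norm_num at h; omega
        · exact Or.inl (Or.inr ⟨hp, h, h'⟩)
    calc S.card ≤ (S₁ ∪ S₂ ∪ S₃).card := Finset.card_le_card this
      _ ≤ (S₁ ∪ S₂).card + S₃.card := Finset.card_union_le _ _
      _ ≤ _ := by gcongr; exact Finset.card_union_le _ _
  have h2 : (S₂.card : ℝ) ≤ 4 * W ^ 2 / Q ^ 2 + 4 * B * W / Q ^ 2 := by
    refine card_pairs_of_pos hQ W B S₂ fun p hp ↦ ?_
    obtain ⟨h1, h2, h3⟩ := Finset.mem_filter.mp hp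
    exact ⟨h3, (le_abs_self _).trans (hS p h1).1, (hS p h1).2, h2⟩
  have h3 : (S₃.card : ℝ) ≤ 4 * W ^ 2 / Q ^ 2 + 4 * B * W / Q ^ 2 := by
    have hinj : Function.Injective fun p : ℤ × ℤ ↦ (-p.1, p.2) := fun p p' h ↦ by
      simp only [Prod.mk.injEq, neg_inj] at h
      exact Prod.ext h.1 h.2
    rw [← Finset.card_image_of_injective S₃ hinj]
    refine card_pairs_of_pos hQ W B _ fun p hp ↦ ?_
    obtain ⟨p', hp', rfl⟩ := Finset.mem_image.mp hp
    obtain ⟨h1, h2, h3⟩ := Finset.mem_filter.mp hp'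
    refine ⟨by simpa using h3, (neg_le_abs _).trans (hS p' h1).1, ?_, ?_⟩
    · simpa only [neg_sq] using (hS p' h1).2
    · simpa only [neg_sq] using h2
  have hmem : ∀ w ∈ S₁.image Prod.fst, |w| ≤ (W : ℤ) ∧ w ^ 2 ≤ (B : ℤ) := by
    intro w hw
    obtain ⟨p, hp, rfl⟩ := Finset.mem_image.mp hw
    obtain ⟨h1, h2⟩ := Finset.mem_filter.mp hp
    exact ⟨(hS p h1).1, h2⟩
  have hT1 : ((S₁.image Prod.fst).card : ℝ) ≤ 2 * √(B : ℝ) + 1 := by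
    have := card_le_of_separated (S₁.image Prod.fst) (δ := 1) (L := 2 * √(B : ℝ))
      one_pos (by positivity) (fun x _ y _ h ↦ hone x y h) (fun x hx y hy ↦ by
        have hb : ∀ w ∈ S₁.image Prod.fst, |(w : ℝ)| ≤ √(B : ℝ) := fun w hw ↦
          Real.abs_le_sqrt (by exact_mod_cast (hmem w hw).2)
        linarith [(abs_le.mp (hb x hx)).1, (abs_le.mp (hb y hy)).2])
    simpa using this
  have hT2 : ((S₁.image Prod.fst).card : ℝ) ≤ 2 * W + 1 := by
    have := card_le_of_separated (S₁.image Prod.fst) (δ := 1) (L := 2 * W)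
      one_pos (by positivity) (fun x _ y _ h ↦ hone x y h) (fun x hx y hy ↦ by
        have hb : ∀ w ∈ S₁.image Prod.fst, |(w : ℝ)| ≤ W := fun w hw ↦ by
          exact_mod_cast (hmem w hw).1
        linarith [(abs_le.mp (hb x hx)).1, (abs_le.mp (hb y hy)).2])
    simpa using this
  have h1 : (S₁.card : ℝ) ≤ (2 * B / Q ^ 2 + 1) * (S₁.image Prod.fst).card := by
    refine card_le_mul_card_of_fiber_le S₁ _ Prod.fst
      (fun x hx ↦ Finset.mem_image_of_mem _ hx) fun w _ ↦ ?_
    set F := S₁.filter fun p ↦ p.1 = w with hF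
    have hF1 : ∀ p ∈ F, p.1 = w := fun p hp ↦ (Finset.mem_filter.mp hp).2
    have hcard : F.card = (F.image Prod.snd).card :=
      (Finset.card_image_of_injOn fun p hp p' hp' h ↦
        Prod.ext ((hF1 p hp).trans (hF1 p' hp').symm) h).symm
    have hm : ∀ j ∈ F.image Prod.snd, |3 * (w : ℝ) ^ 2 - j * Q ^ 2| ≤ (B : ℝ) := by
      intro j hj
      obtain ⟨p, hp, rfl⟩ := Finset.mem_image.mp hj
      have h5 := (hS p (Finset.mem_filter.mp (Finset.mem_filter.mp hp).1).1).2
      rw [hF1 p hp] at h5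
      exact_mod_cast h5
    rw [hcard]
    have := card_le_of_separated (F.image Prod.snd) (δ := 1) (L := 2 * B / Q ^ 2)
      one_pos (by positivity) (fun x _ y _ h ↦ hone x y h) (fun x hx y hy ↦ by
        rw [le_div_iff₀ (by positivity)]
        linarith [(abs_le.mp (hm x hx)).2, (abs_le.mp (hm y hy)).1])
    simpa using this
  have h1' : (S₁.card : ℝ) ≤ 2 * B / Q ^ 2 * (2 * W + 1) + (2 * √(B : ℝ) + 1) := by
    calc (S₁.card : ℝ) ≤ _ := h1
      _ = 2 * B / Q ^ 2 * (S₁.image Prod.fst).card + (S₁.image Prod.fst).card := by ring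
      _ ≤ _ := by gcongr
  have hcr : (S.card : ℝ) ≤ S₁.card + S₂.card + S₃.card := by exact_mod_cast hcard
  calc (S.card : ℝ) ≤ _ := hcr
    _ ≤ (2 * B / Q ^ 2 * (2 * W + 1) + (2 * √(B : ℝ) + 1)) +
        (4 * W ^ 2 / Q ^ 2 + 4 * B * W / Q ^ 2) + (4 * W ^ 2 / Q ^ 2 + 4 * B * W / Q ^ 2) := by
      gcongr
    _ = _ := by ring

theorem dvd_of_sq_dvd_three_mul_sq {Q w : ℤ} (hQ : Q ≠ 0) (h : Q ^ 2 ∣ 3 * w ^ 2) : Q ∣ w := by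
  obtain ⟨Q', w', hco, hQ', hw'⟩ := Int.exists_gcd_one (m := Q) (n := w)
    (Int.gcd_pos_of_ne_zero_left _ hQ)
  set g : ℤ := (Int.gcd Q w : ℤ) with hg
  have hg0 : g ≠ 0 := fun h0 ↦ hQ (by rw [hQ', h0, mul_zero])
  have h1 : Q' ^ 2 ∣ 3 * w' ^ 2 := by
    rw [hQ', hw', mul_pow, mul_pow, ← mul_assoc] at h
    exact Int.dvd_of_mul_dvd_mul_right (pow_ne_zero 2 hg0) h
  have h2 : Q' ^ 2 ∣ 3 :=
    ((Int.isCoprime_iff_gcd_eq_one.mpr hco).pow).dvd_of_dvd_mul_right h1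
  have h3 : Q' ^ 2 ≤ 3 := Int.le_of_dvd (by norm_num) h2
  have h4 : Q' ≠ 0 := fun h0 ↦ hQ (by rw [hQ', h0, zero_mul])
  have h5 : Q' ∣ 1 := by
    have h6 : -1 ≤ Q' := by nlinarith
    have h7 : Q' ≤ 1 := by nlinarith
    obtain h8 | h8 | h8 : Q' = -1 ∨ Q' = 0 ∨ Q' = 1 := by omega
    · exact ⟨-1, by rw [h8]; norm_num⟩
    · exact absurd h8 h4
    · exact h8.dvd
  rw [hQ', hw']
  exact mul_dvd_mul (h5.trans (one_dvd _)) dvd_rfl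

theorem card_erase_zero_Icc (X : ℕ) : ((Finset.Icc (-X : ℤ) X).erase 0).card = 2 * X := by
  rw [Finset.card_erase_of_mem (by simp), Int.card_Icc]
  omega

/-- Multiples of `N` in `[-W, W]`. -/
theorem card_multiples_le {N : ℝ} (hN : 0 < N) {W : ℝ} (hW : 0 ≤ W) (S : Finset ℤ)
    (hS : ∀ w ∈ S, |(w : ℝ)| ≤ W) (hdvd : ∀ x ∈ S, ∀ y ∈ S, x < y → N ≤ (y : ℝ) - x) :
    (S.card : ℝ) ≤ 2 * W / N + 1 :=
  card_le_of_separated S hN (by positivity) hdvd fun x hx y hy ↦ by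
    linarith [(abs_le.mp (hS x hx)).1, (abs_le.mp (hS y hy)).2]

theorem le_sub_of_dvd {N x y : ℤ} (h : x < y) (hd : N ∣ y - x) : (N : ℝ) ≤ (y : ℝ) - x := by
  exact_mod_cast Int.le_of_dvd (by linarith) hd

/-- Factorizations of a nonzero integer. -/
theorem card_le_two_mul_card_divisors {n : ℕ} (hn : n ≠ 0) (S : Finset ℤ)
    (hS : ∀ x ∈ S, x.natAbs ∣ n) : S.card ≤ 2 * n.divisors.card := by
  have : S ⊆ n.divisors.image (fun d : ℕ ↦ (d : ℤ)) ∪ n.divisors.image (fun d : ℕ ↦ -(d : ℤ)) := by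
    intro x hx
    have := hS x hx
    rw [Finset.mem_union, Finset.mem_image, Finset.mem_image]
    rcases Int.natAbs_eq x with h | h
    · exact Or.inl ⟨x.natAbs, Nat.mem_divisors.mpr ⟨this, hn⟩, h.symm⟩
    · exact Or.inr ⟨x.natAbs, Nat.mem_divisors.mpr ⟨this, hn⟩, h.symm⟩
  calc S.card ≤ _ := Finset.card_le_card this
    _ ≤ _ := Finset.card_union_le _ _
    _ ≤ n.divisors.card + n.divisors.card := add_le_add Finset.card_image_le Finset.card_image_le
    _ = _ := by ring

theorem card_triples {Q : ℕ} (hQ : 0 < Q) (X W Z : ℕ) {D : ℝ} (hD1 : 1 ≤ D)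
    (hD : ∀ n : ℕ, n ≠ 0 → n ≤ 4 * X * Z → (n.divisors.card : ℝ) ≤ D)
    (S : Finset (ℤ × ℤ × ℤ))
    (hS : ∀ p ∈ S, p.1 ≠ 0 ∧ |p.1| ≤ X ∧ |p.2.1| ≤ W ∧ |p.2.2| ≤ Z ∧
      (Q : ℤ) ^ 2 ∣ 3 * p.2.1 ^ 2 - 4 * p.1 * p.2.2) :
    (S.card : ℝ) ≤ (2 * W / Q + 1) * (2 * X) +
      2 * D * (1 + 2 * √((4 * X * Z : ℕ) : ℝ) + (12 * W + 2) * (4 * X * Z : ℕ) / Q ^ 2 +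
        8 * W ^ 2 / Q ^ 2) := by
  have hQr : (0 : ℝ) < Q := by exact_mod_cast hQ
  have hQz : (Q : ℤ) ≠ 0 := by exact_mod_cast hQ.ne'
  have h0 : ((S.filter fun p ↦ p.2.2 = 0).card : ℝ) ≤ (2 * W / Q + 1) * (2 * X) := by
    have := card_le_mul_card_of_fiber_le (S.filter fun p ↦ p.2.2 = 0)
      ((Finset.Icc (-X : ℤ) X).erase 0) Prod.fst (c := 2 * W / Q + 1) (fun p hp ↦ by
        obtain ⟨h1, h2, -⟩ := hS p (Finset.mem_filter.mp hp).1
        simpa using ⟨h1, abs_le.mp h2⟩) (fun x hx ↦ by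
        set F := (S.filter fun p ↦ p.2.2 = 0).filter fun p ↦ p.1 = x with hF
        have hFm : ∀ p ∈ F, p ∈ S ∧ p.2.2 = 0 ∧ p.1 = x := fun p hp ↦ by
          simpa [hF, and_assoc] using hp
        have hcard : F.card = (F.image fun p ↦ p.2.1).card :=
          (Finset.card_image_of_injOn fun p hp p' hp' h ↦ by
            obtain ⟨-, h1, h2⟩ := hFm p hp
            obtain ⟨-, h1', h2'⟩ := hFm p' hp'
            exact Prod.ext (h2.trans h2'.symm) (Prod.ext h (h1.trans h1'.symm))).symm
        have hm : ∀ w ∈ F.image fun p ↦ p.2.1, |w| ≤ (W : ℤ) ∧ (Q : ℤ) ∣ w := by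
          intro w hw
          obtain ⟨p, hp, rfl⟩ := Finset.mem_image.mp hw
          obtain ⟨h1, h2, h3⟩ := hFm p hp
          obtain ⟨-, -, h4, -, h5⟩ := hS p h1
          refine ⟨h4, dvd_of_sq_dvd_three_mul_sq hQz ?_⟩
          simpa [h2] using h5
        rw [hcard]
        exact card_multiples_le hQr (by positivity) _
          (fun w hw ↦ by exact_mod_cast (hm w hw).1)
          (fun x hx y hy hxy ↦ by
            exact_mod_cast le_sub_of_dvd hxy (dvd_sub (hm y hy).2 (hm x hx).2)))
    rw [card_erase_zero_Icc] at this
    push_cast at this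
    exact this
  set T := S.filter fun p ↦ p.2.2 ≠ 0 with hT
  set f : ℤ × ℤ × ℤ → ℤ × ℤ :=
    fun p ↦ (p.2.1, (3 * p.2.1 ^ 2 - 4 * p.1 * p.2.2) / (Q : ℤ) ^ 2) with hf
  have hfeq : ∀ p ∈ S, 3 * (f p).1 ^ 2 - (f p).2 * (Q : ℤ) ^ 2 = 4 * p.1 * p.2.2 := by
    intro p hp
    have := Int.ediv_mul_cancel (hS p hp).2.2.2.2
    simp only [hf]
    linarith
  have habs : ∀ p ∈ S, |4 * p.1 * p.2.2| ≤ ((4 * X * Z : ℕ) : ℤ) := by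
    intro p hp
    obtain ⟨-, h1, -, h2, -⟩ := hS p hp
    rw [abs_mul, abs_mul]
    push_cast
    have : |(4 : ℤ)| = 4 := rfl
    rw [this]
    gcongr
  have hpairs := card_pairs hQ W (4 * X * Z) (T.image f) (fun y hy ↦ by
    obtain ⟨p, hp, rfl⟩ := Finset.mem_image.mp hy
    have hpS := (Finset.mem_filter.mp hp).1
    rw [hfeq p hpS]
    exact ⟨(hS p hpS).2.2.1, habs p hpS⟩)
  have h1 : (T.card : ℝ) ≤ 2 * D * (T.image f).card := by
    refine card_le_mul_card_of_fiber_le T _ f (fun p hp ↦ Finset.mem_image_of_mem _ hp) ?_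
    intro y hy
    obtain ⟨p₀, hp₀, rfl⟩ := Finset.mem_image.mp hy
    set F := T.filter fun p ↦ f p = f p₀ with hF
    obtain ⟨hp₀S, hp₀z⟩ := Finset.mem_filter.mp hp₀
    have hFm : ∀ p ∈ F, p ∈ S ∧ f p = f p₀ := fun p hp ↦
      ⟨(Finset.mem_filter.mp (Finset.mem_filter.mp hp).1).1, (Finset.mem_filter.mp hp).2⟩
    have heq : ∀ p ∈ F, 4 * p.1 * p.2.2 = 4 * p₀.1 * p₀.2.2 := fun p hp ↦ by
      rw [← hfeq p (hFm p hp).1, ← hfeq p₀ hp₀S, (hFm p hp).2]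
    have hcard : F.card = (F.image Prod.fst).card := by
      refine (Finset.card_image_of_injOn fun p hp p' hp' h ↦ ?_).symm
      have h2 : (f p).1 = (f p').1 :=
        congrArg Prod.fst ((hFm p hp).2.trans (hFm p' hp').2.symm)
      have h3 := (heq p hp).trans (heq p' hp').symm
      have h4 := (hS p (hFm p hp).1).1
      have h5 : p.2.2 = p'.2.2 := by
        rw [← h] at h3
        exact mul_left_cancel₀ (mul_ne_zero four_ne_zero h4) h3
      exact Prod.ext h (Prod.ext h2 h5)
    have hn0 : (4 * p₀.1 * p₀.2.2).natAbs ≠ 0 :=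
      Int.natAbs_ne_zero.mpr (mul_ne_zero (mul_ne_zero four_ne_zero (hS p₀ hp₀S).1) hp₀z)
    have hle : (4 * p₀.1 * p₀.2.2).natAbs ≤ 4 * X * Z := by
      have := habs p₀ hp₀S
      rw [Int.abs_eq_natAbs] at this
      exact_mod_cast this
    rw [hcard]
    have h2 := card_le_two_mul_card_divisors hn0 (F.image Prod.fst) (fun x hx ↦ by
      obtain ⟨p, hp, rfl⟩ := Finset.mem_image.mp hx
      rw [Int.natAbs_dvd_natAbs, ← heq p hp]
      exact ⟨4 * p.2.2, by ring⟩)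
    calc ((F.image Prod.fst).card : ℝ) ≤ 2 * ((4 * p₀.1 * p₀.2.2).natAbs.divisors.card : ℝ) := by
          exact_mod_cast h2
      _ ≤ 2 * D := by gcongr; exact hD _ hn0 hle
  have hcard : S.card = (S.filter fun p ↦ p.2.2 = 0).card + T.card :=
    (Finset.card_filter_add_card_filter_not _).symm
  rw [hcard]
  push_cast at *
  refine add_le_add h0 (h1.trans ?_)
  gcongr

/-- For a fixed triple `(x, w, z)` with `gcd (x, w, z, Q) = d`, the number of `a` modulo `Q` whose
lattice contains the triple. -/
theorem card_residues_le {Q : ℕ} (hQ : 0 < Q) (x w z : ℤ) (F : Finset ℤ)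
    (hF : ∀ a ∈ F, 0 ≤ a ∧ a < Q ∧ (Q : ℤ) ∣ w - 2 * a * x ∧
      (Q : ℤ) ^ 2 ∣ z - (3 * a * w - 3 * a ^ 2 * x)) :
    (F.card : ℝ) ≤ 3 * ((Int.gcd x w).gcd (Int.gcd z Q) : ℕ) := by
  set d : ℕ := (Int.gcd x w).gcd (Int.gcd z Q) with hd
  have hdpos : 0 < d :=
    Nat.gcd_pos_of_pos_right _ (Int.gcd_pos_of_ne_zero_right _ (by exact_mod_cast hQ.ne'))
  have hd0 : (d : ℤ) ≠ 0 := by exact_mod_cast hdpos.ne'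
  have hdxw : d ∣ Int.gcd x w := Nat.gcd_dvd_left _ _
  have hdzQ : d ∣ Int.gcd z Q := Nat.gcd_dvd_right _ _
  have hdvd : ∀ e : ℤ, e ∣ x → e ∣ w → e ∣ z → e ∣ Q → e ∣ d := fun e h1 h2 h3 h4 ↦
    Int.dvd_coe_gcd (a := Int.gcd x w) (b := Int.gcd z Q)
      (Int.dvd_coe_gcd h1 h2) (Int.dvd_coe_gcd h3 h4)
  clear_value d
  obtain ⟨x', rfl⟩ : (d : ℤ) ∣ x :=
    (Int.natCast_dvd_natCast.mpr hdxw).trans (Int.gcd_dvd_left _ _)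
  obtain ⟨w', rfl⟩ : (d : ℤ) ∣ w :=
    (Int.natCast_dvd_natCast.mpr hdxw).trans (Int.gcd_dvd_right _ _)
  obtain ⟨z', rfl⟩ : (d : ℤ) ∣ z :=
    (Int.natCast_dvd_natCast.mpr hdzQ).trans (Int.gcd_dvd_left _ _)
  obtain ⟨Q', hQ'⟩ : (d : ℤ) ∣ Q :=
    (Int.natCast_dvd_natCast.mpr hdzQ).trans (Int.gcd_dvd_right _ _)
  rw [hQ'] at hdvd
  have hQ'pos : 0 < Q' := by
    have h1 : (0 : ℤ) < d * Q' := by rw [← hQ']; exact_mod_cast hQ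
    exact pos_of_mul_pos_right h1 (by positivity)
  rcases F.eq_empty_or_nonempty with rfl | ⟨a₀, ha₀⟩
  · simp
  have hw : ∀ a ∈ F, Q' ∣ w' - 2 * a * x' := fun a ha ↦ by
    have h1 := (hF a ha).2.2.1
    rw [hQ', show (d : ℤ) * w' - 2 * a * (d * x') = d * (w' - 2 * a * x') by ring] at h1
    exact Int.dvd_of_mul_dvd_mul_left hd0 h1
  have hco : IsCoprime Q' x' := by
    rw [Int.isCoprime_iff_gcd_eq_one]
    set g : ℤ := (Int.gcd Q' x' : ℤ) with hg
    have hgQ : g ∣ Q' := Int.gcd_dvd_left _ _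
    have hgx : g ∣ x' := Int.gcd_dvd_right _ _
    have hgw : g ∣ w' := by
      have h1 := hgQ.trans (hw a₀ ha₀)
      have h2 := dvd_add h1 (hgx.mul_left (2 * a₀))
      simpa using h2
    have hgz : g ∣ z' := by
      have h1 := (hF a₀ ha₀).2.2.2
      have h2 : (d : ℤ) * Q' ∣ d * (z' - (3 * a₀ * w' - 3 * a₀ ^ 2 * x')) := by
        refine ((dvd_pow_self _ two_ne_zero).trans (hQ' ▸ h1)).trans (dvd_of_eq ?_)
        ring
      have h3 := hgQ.trans (Int.dvd_of_mul_dvd_mul_left hd0 h2)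
      have h4 := dvd_add h3
        (dvd_sub (hgw.mul_left (3 * a₀)) (hgx.mul_left (3 * a₀ ^ 2)))
      simpa using h4
    have h5 := hdvd (d * g) (mul_dvd_mul_left _ hgx) (mul_dvd_mul_left _ hgw)
      (mul_dvd_mul_left _ hgz) (mul_dvd_mul_left _ hgQ)
    have h6 : g ∣ 1 := by
      rw [← mul_dvd_mul_iff_left hd0, mul_one]
      exact h5
    have h7 : g = 1 := Int.eq_one_of_dvd_one (by positivity) h6
    rw [hg] at h7
    exact_mod_cast h7
  have hdiff : ∀ a ∈ F, ∀ b ∈ F, Q' ∣ 2 * b - 2 * a := fun a ha b hb ↦ by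
    have h1 := dvd_sub (hw a ha) (hw b hb)
    rw [show w' - 2 * a * x' - (w' - 2 * b * x') = (2 * b - 2 * a) * x' by ring] at h1
    exact hco.dvd_of_dvd_mul_right h1
  have hQ'r : (0 : ℝ) < Q' := by exact_mod_cast hQ'pos
  have hQr : (Q : ℝ) = d * Q' := by exact_mod_cast hQ'
  have h1 := card_le_of_separated F (δ := (Q' : ℝ) / 2) (L := Q) (by positivity) (by positivity)
    (fun a ha b hb hab ↦ by
      have := le_sub_of_dvd (by linarith) (hdiff a ha b hb)
      push_cast at this
      linarith)
    (fun a ha b hb ↦ by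
      have h2 : (b : ℝ) < Q := by exact_mod_cast (hF b hb).2.1
      have h3 : (0 : ℝ) ≤ a := by exact_mod_cast (hF a ha).1
      linarith)
  have h2 : (Q : ℝ) / (Q' / 2) = 2 * d := by rw [hQr]; field_simp
  have h3 : (1 : ℝ) ≤ d := by exact_mod_cast hdpos
  linarith

theorem sq_dvd_discrim {Q a x w z : ℤ} (hw : Q ∣ w - 2 * a * x)
    (hz : Q ^ 2 ∣ z - (3 * a * w - 3 * a ^ 2 * x)) : Q ^ 2 ∣ 3 * w ^ 2 - 4 * x * z := by
  obtain ⟨k, hk⟩ := hw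
  obtain ⟨l, hl⟩ := hz
  obtain rfl : w = 2 * a * x + Q * k := by linarith
  obtain rfl : z = 3 * a * (2 * a * x + Q * k) - 3 * a ^ 2 * x + Q ^ 2 * l := by linarith
  exact ⟨3 * k ^ 2 - 4 * x * l, by ring⟩

theorem abs_div_le_div {x : ℤ} {d X : ℕ} (hd : 0 < d) (hdx : (d : ℤ) ∣ x) (h : |x| ≤ X) :
    |x / d| ≤ ((X / d : ℕ) : ℤ) := by
  obtain ⟨y, rfl⟩ := hdx
  have hd' : (0 : ℤ) < d := by exact_mod_cast hd
  rw [Int.mul_ediv_cancel_left _ hd'.ne', Int.natCast_ediv, Int.le_ediv_iff_mul_le hd']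
  rwa [abs_mul, abs_of_pos hd', mul_comm] at h

/-- Lattice points `(x, w, z)` with `x ≠ 0` and `gcd (x, w, z, Q) = d`, over all lattices. -/
theorem card_lattice_points_of_gcd_eq {Q : ℕ} (hQ : 0 < Q) (X W Z : ℕ) {D : ℝ} (hD1 : 1 ≤ D)
    (hD : ∀ n : ℕ, n ≠ 0 → n ≤ 4 * X * Z → (n.divisors.card : ℝ) ≤ D) {d : ℕ} (hdQ : d ∣ Q)
    (R : Finset (ℤ × ℤ × ℤ × ℤ))
    (hR : ∀ r ∈ R, (0 ≤ r.1 ∧ r.1 < Q ∧ (Q : ℤ) ∣ r.2.2.1 - 2 * r.1 * r.2.1 ∧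
      (Q : ℤ) ^ 2 ∣ r.2.2.2 - (3 * r.1 * r.2.2.1 - 3 * r.1 ^ 2 * r.2.1)) ∧
      |r.2.1| ≤ X ∧ |r.2.2.1| ≤ W ∧ |r.2.2.2| ≤ Z)
    (hR0 : ∀ r ∈ R, r.2.1 ≠ 0)
    (hRd : ∀ r ∈ R, (Int.gcd r.2.1 r.2.2.1).gcd (Int.gcd r.2.2.2 Q) = d) :
    (R.card : ℝ) ≤ 3 * d * ((2 * (W / d : ℕ) / (Q / d : ℕ) + 1) * (2 * (X / d : ℕ)) +
      2 * D * (1 + 2 * √((4 * (X / d) * (Z / d) : ℕ) : ℝ) +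
        (12 * (W / d : ℕ) + 2) * (4 * (X / d) * (Z / d) : ℕ) / (Q / d : ℕ) ^ 2 +
        8 * (W / d : ℕ) ^ 2 / (Q / d : ℕ) ^ 2)) := by
  have hd : 0 < d := Nat.pos_of_dvd_of_pos hdQ hQ
  have hdz : (d : ℤ) ≠ 0 := by exact_mod_cast hd.ne'
  have h1 : (R.card : ℝ) ≤ 3 * d * (R.image Prod.snd).card := by
    refine card_le_mul_card_of_fiber_le R _ Prod.snd
      (fun r hr ↦ Finset.mem_image_of_mem _ hr) fun t ht ↦ ?_
    obtain ⟨r₀, hr₀, rfl⟩ := Finset.mem_image.mp ht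
    set F := R.filter fun r ↦ r.2 = r₀.2 with hF
    have hFm : ∀ r ∈ F, r ∈ R ∧ r.2 = r₀.2 := fun r hr ↦ Finset.mem_filter.mp hr
    have hcard : F.card = (F.image Prod.fst).card :=
      (Finset.card_image_of_injOn fun r hr r' hr' h ↦
        Prod.ext h ((hFm r hr).2.trans (hFm r' hr').2.symm)).symm
    rw [hcard, ← hRd r₀ hr₀]
    refine card_residues_le hQ _ _ _ _ fun a ha ↦ ?_
    obtain ⟨r, hr, rfl⟩ := Finset.mem_image.mp ha
    obtain ⟨h2, h3⟩ := hFm r hr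
    rw [← h3]
    exact (hR r h2).1
  have hdvd : ∀ t ∈ R.image Prod.snd, (d : ℤ) ∣ t.1 ∧ (d : ℤ) ∣ t.2.1 ∧ (d : ℤ) ∣ t.2.2 := by
    intro t ht
    obtain ⟨r, hr, rfl⟩ := Finset.mem_image.mp ht
    have h2 := hRd r hr
    have h3 : d ∣ Int.gcd r.2.1 r.2.2.1 := h2 ▸ Nat.gcd_dvd_left _ _
    have h4 : d ∣ Int.gcd r.2.2.2 Q := h2 ▸ Nat.gcd_dvd_right _ _
    have h3' := Int.natCast_dvd_natCast.mpr h3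
    have h4' := Int.natCast_dvd_natCast.mpr h4
    exact ⟨h3'.trans (Int.gcd_dvd_left _ _), h3'.trans (Int.gcd_dvd_right _ _),
      h4'.trans (Int.gcd_dvd_left _ _)⟩
  set g : ℤ × ℤ × ℤ → ℤ × ℤ × ℤ := fun t ↦ (t.1 / d, t.2.1 / d, t.2.2 / d) with hg
  have hcard : (R.image Prod.snd).card = ((R.image Prod.snd).image g).card := by
    refine (Finset.card_image_of_injOn fun t ht t' ht' h ↦ ?_).symm
    simp only [hg, Prod.mk.injEq] at h
    obtain ⟨a1, a2, a3⟩ := hdvd t ht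
    obtain ⟨b1, b2, b3⟩ := hdvd t' ht'
    exact Prod.ext ((Int.ediv_left_inj a1 b1).mp h.1)
      (Prod.ext ((Int.ediv_left_inj a2 b2).mp h.2.1) ((Int.ediv_left_inj a3 b3).mp h.2.2))
  refine h1.trans ?_
  rw [hcard]
  refine mul_le_mul_of_nonneg_left ?_ (by positivity)
  refine card_triples (Nat.div_pos (Nat.le_of_dvd hQ hdQ) hd) (X / d) (W / d) (Z / d) hD1
    (fun n hn hle ↦ hD n hn (hle.trans ?_)) _ fun t ht ↦ ?_
  · gcongr <;> exact Nat.div_le_self _ _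
  · obtain ⟨t', ht', rfl⟩ := Finset.mem_image.mp ht
    obtain ⟨a1, a2, a3⟩ := hdvd t' ht'
    obtain ⟨r, hr, rfl⟩ := Finset.mem_image.mp ht'
    obtain ⟨⟨-, -, h2, h3⟩, h4, h5, h6⟩ := hR r hr
    simp only [hg]
    refine ⟨?_, abs_div_le_div hd a1 h4, abs_div_le_div hd a2 h5, abs_div_le_div hd a3 h6, ?_⟩
    · intro h7
      exact hR0 r hr (by rw [← Int.ediv_mul_cancel a1, h7, zero_mul])
    · have h7 := sq_dvd_discrim h2 h3
      obtain ⟨Q', rfl⟩ := hdQ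
      obtain ⟨x', hx⟩ := a1
      obtain ⟨w', hw⟩ := a2
      obtain ⟨z', hz⟩ := a3
      rw [hx, hw, hz] at h7 ⊢
      rw [Nat.mul_div_cancel_left _ hd]
      simp only [Int.mul_ediv_cancel_left _ hdz]
      push_cast at h7
      rw [mul_pow, show 3 * ((d : ℤ) * w') ^ 2 - 4 * (d * x') * (d * z') =
        d ^ 2 * (3 * w' ^ 2 - 4 * x' * z') by ring] at h7
      exact Int.dvd_of_mul_dvd_mul_left (pow_ne_zero 2 hdz) h7

/-- Lattice points `(0, w, z)` with `w = 0`, over all lattices. -/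
theorem card_lattice_points_zero_zero {Q : ℕ} (hQ : 0 < Q) (Z : ℕ) (R : Finset (ℤ × ℤ × ℤ))
    (hR : ∀ r ∈ R, 0 ≤ r.1 ∧ r.1 < Q ∧ r.2.1 = 0 ∧ (Q : ℤ) ^ 2 ∣ r.2.2 ∧ |r.2.2| ≤ Z) :
    (R.card : ℝ) ≤ Q + 2 * Z / Q := by
  have hQr : (0 : ℝ) < Q := by exact_mod_cast hQ
  have h1 := card_le_mul_card_of_fiber_le R (Finset.Ico (0 : ℤ) Q) Prod.fst
    (c := 2 * Z / (Q : ℝ) ^ 2 + 1) (fun r hr ↦ by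
      obtain ⟨h1, h2, -⟩ := hR r hr
      exact Finset.mem_Ico.mpr ⟨h1, h2⟩) (fun a _ ↦ by
      set F := R.filter fun r ↦ r.1 = a with hF
      have hFm : ∀ r ∈ F, r ∈ R ∧ r.1 = a := fun r hr ↦ Finset.mem_filter.mp hr
      have hcard : F.card = (F.image fun r ↦ r.2.2).card :=
        (Finset.card_image_of_injOn fun r hr r' hr' h ↦ by
          have h1 := hFm r hr
          have h2 := hFm r' hr'
          exact Prod.ext (h1.2.trans h2.2.symm)
            (Prod.ext ((hR r h1.1).2.2.1.trans (hR r' h2.1).2.2.1.symm) h)).symm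
      have hm : ∀ z ∈ F.image fun r ↦ r.2.2, (Q : ℤ) ^ 2 ∣ z ∧ |z| ≤ (Z : ℤ) := fun z hz ↦ by
        obtain ⟨r, hr, rfl⟩ := Finset.mem_image.mp hz
        exact (hR r (hFm r hr).1).2.2.2
      rw [hcard]
      exact card_multiples_le (by positivity) (by positivity) _
        (fun z hz ↦ by exact_mod_cast (hm z hz).2)
        (fun x hx y hy hxy ↦ by
          exact_mod_cast le_sub_of_dvd hxy (dvd_sub (hm y hy).1 (hm x hx).1)))
  rw [Int.card_Ico, sub_zero, Int.toNat_natCast] at h1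
  refine h1.trans (le_of_eq ?_)
  field_simp
  ring

/-- Lattice points `(0, w, z)` with `w` a fixed nonzero multiple of `Q`, over all lattices. -/
theorem card_lattice_points_zero_fiber {Q : ℕ} (hQ : 0 < Q) (Z : ℕ) (k : ℤ)
    (R : Finset (ℤ × ℤ))
    (hR : ∀ r ∈ R, 0 ≤ r.1 ∧ r.1 < Q ∧ (Q : ℤ) ^ 2 ∣ r.2 - 3 * r.1 * (Q * k) ∧ |r.2| ≤ Z) :
    (R.card : ℝ) ≤ 4 * Z / Q + 6 * Int.gcd k Q := by
  have hQr : (0 : ℝ) < Q := by exact_mod_cast hQ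
  have hQz : (Q : ℤ) ≠ 0 := by exact_mod_cast hQ.ne'
  obtain ⟨k', Q', hco, hk', hQ'⟩ := Int.exists_gcd_one (m := 3 * k) (n := Q)
    (Int.gcd_pos_of_ne_zero_right _ hQz)
  set g : ℕ := Int.gcd (3 * k) Q with hg
  have hgpos : 0 < g := Int.gcd_pos_of_ne_zero_right _ hQz
  have hg0 : (g : ℤ) ≠ 0 := by exact_mod_cast hgpos.ne'
  have hgr : (1 : ℝ) ≤ g := by exact_mod_cast hgpos
  have hgle : (g : ℝ) ≤ 3 * Int.gcd k Q := by
    have h1 : g ∣ 3 * Int.gcd k Q := by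
      have h2 : Int.gcd (3 * k) (3 * Q) = 3 * Int.gcd k Q := by
        rw [Int.gcd_mul_left]; rfl
      rw [← h2]
      exact Int.dvd_gcd (Int.gcd_dvd_left _ _) ((Int.gcd_dvd_right _ _).mul_left 3)
    have h2 := Nat.le_of_dvd
      (mul_pos (by norm_num) (Int.gcd_pos_of_ne_zero_right _ hQz)) h1
    exact_mod_cast h2
  have hQ'pos : 0 < Q' := by
    have h1 : (0 : ℤ) < Q' * g := by rw [← hQ']; exact_mod_cast hQ
    exact pos_of_mul_pos_left h1 (by positivity)
  have hQ'r : (0 : ℝ) < Q' := by exact_mod_cast hQ'pos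
  have hQQ' : (Q : ℝ) = Q' * g := by exact_mod_cast hQ'
  have hm : ∀ z ∈ R.image Prod.snd, (Q * g : ℤ) ∣ z ∧ |z| ≤ (Z : ℤ) := fun z hz ↦ by
    obtain ⟨r, hr, rfl⟩ := Finset.mem_image.mp hz
    obtain ⟨-, -, h1, h2⟩ := hR r hr
    refine ⟨?_, h2⟩
    have h3 : (Q * g : ℤ) ∣ (Q : ℤ) ^ 2 := by
      rw [sq]; exact mul_dvd_mul_left _ (Int.gcd_dvd_right _ _)
    have h4 : (Q * g : ℤ) ∣ 3 * r.1 * (Q * k) := by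
      rw [show 3 * r.1 * (Q * k) = Q * (3 * k) * r.1 by ring]
      exact (mul_dvd_mul_left _ (Int.gcd_dvd_left _ _)).mul_right _
    simpa using dvd_add (h3.trans h1) h4
  have hz : ((R.image Prod.snd).card : ℝ) ≤ 2 * Z / (Q * g) + 1 :=
    card_multiples_le (by positivity) (by positivity) _
      (fun z hz ↦ by exact_mod_cast (hm z hz).2)
      (fun x hx y hy hxy ↦ by
        exact_mod_cast le_sub_of_dvd hxy (dvd_sub (hm y hy).1 (hm x hx).1))
  have h1 : (R.card : ℝ) ≤ (2 * g) * (R.image Prod.snd).card := by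
    refine card_le_mul_card_of_fiber_le R _ Prod.snd
      (fun r hr ↦ Finset.mem_image_of_mem _ hr) fun z _ ↦ ?_
    set F := R.filter fun r ↦ r.2 = z with hF
    have hFm : ∀ r ∈ F, r ∈ R ∧ r.2 = z := fun r hr ↦ Finset.mem_filter.mp hr
    have hcard : F.card = (F.image Prod.fst).card :=
      (Finset.card_image_of_injOn fun r hr r' hr' h ↦
        Prod.ext h ((hFm r hr).2.trans (hFm r' hr').2.symm)).symm
    have ha : ∀ a ∈ F.image Prod.fst, 0 ≤ a ∧ a < Q ∧ (Q : ℤ) ^ 2 ∣ z - 3 * a * (Q * k) := by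
      intro a ha
      obtain ⟨r, hr, rfl⟩ := Finset.mem_image.mp ha
      obtain ⟨h1, h2, h3, -⟩ := hR r (hFm r hr).1
      rw [(hFm r hr).2] at h3
      exact ⟨h1, h2, h3⟩
    have hdiff : ∀ a ∈ F.image Prod.fst, ∀ b ∈ F.image Prod.fst, Q' ∣ b - a := by
      intro a ha' b hb'
      have h1 := dvd_sub (ha a ha').2.2 (ha b hb').2.2
      rw [show z - 3 * a * (Q * k) - (z - 3 * b * (Q * k)) = Q * ((b - a) * (3 * k)) by ring,
        sq] at h1
      have h2 := Int.dvd_of_mul_dvd_mul_left hQz h1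
      rw [hk', ← mul_assoc, hQ'] at h2
      have h3 := Int.dvd_of_mul_dvd_mul_right hg0 h2
      exact (Int.isCoprime_iff_gcd_eq_one.mpr hco).symm.dvd_of_dvd_mul_right h3
    rw [hcard]
    have h2 := card_le_of_separated (F.image Prod.fst) (δ := Q') (L := Q) hQ'r hQr.le
      (fun a ha' b hb' hab ↦ le_sub_of_dvd hab (hdiff a ha' b hb'))
      (fun a ha' b hb' ↦ by
        have h2 : (b : ℝ) < Q := by exact_mod_cast (ha b hb').2.1
        have h3 : (0 : ℝ) ≤ a := by exact_mod_cast (ha a ha').1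
        linarith)
    have h3 : (Q : ℝ) / Q' = g := by rw [hQQ']; field_simp
    linarith
  calc (R.card : ℝ) ≤ _ := h1
    _ ≤ 2 * g * (2 * Z / (Q * g) + 1) := by gcongr
    _ = 4 * Z / Q + 2 * g := by field_simp; ring
    _ ≤ _ := by linarith

/-- Lattice points `(0, w, z)` with `w ≠ 0`, over all lattices. -/
theorem card_lattice_points_zero {Q : ℕ} (hQ : 0 < Q) (W Z : ℕ) (R : Finset (ℤ × ℤ × ℤ))
    (hR : ∀ r ∈ R, 0 ≤ r.1 ∧ r.1 < Q ∧ (Q : ℤ) ∣ r.2.1 ∧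
      (Q : ℤ) ^ 2 ∣ r.2.2 - 3 * r.1 * r.2.1 ∧ r.2.1 ≠ 0 ∧ |r.2.1| ≤ W ∧ |r.2.2| ≤ Z) :
    (R.card : ℝ) ≤ Q.divisors.card * (8 * Z * W / Q ^ 2 + 12 * W / Q) := by
  have hQr : (0 : ℝ) < Q := by exact_mod_cast hQ
  have hQz : (Q : ℤ) ≠ 0 := by exact_mod_cast hQ.ne'
  set f : ℤ × ℤ × ℤ → ℕ := fun r ↦ Int.gcd (r.2.1 / Q) Q with hf
  rw [Finset.card_eq_sum_card_fiberwise (f := f) (t := Q.divisors) (fun r _ ↦ by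
    refine Finset.mem_coe.mpr (Nat.mem_divisors.mpr ⟨?_, hQ.ne'⟩)
    exact Int.natCast_dvd_natCast.mp (Int.gcd_dvd_right _ _))]
  push_cast
  rw [← nsmul_eq_mul, ← Finset.sum_const]
  refine Finset.sum_le_sum fun c hc ↦ ?_
  have hcpos : 0 < c := Nat.pos_of_mem_divisors hc
  have hcr : (1 : ℝ) ≤ c := by exact_mod_cast hcpos
  set F := R.filter fun r ↦ f r = c with hF
  have hFm : ∀ r ∈ F, r ∈ R ∧ f r = c := fun r hr ↦ Finset.mem_filter.mp hr
  have hm : ∀ w ∈ F.image (fun r ↦ r.2.1), w ≠ 0 ∧ |w| ≤ (W : ℤ) ∧ (Q * c : ℤ) ∣ w := by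
    intro w hw
    obtain ⟨r, hr, rfl⟩ := Finset.mem_image.mp hw
    obtain ⟨-, -, h1, -, h2, h3, -⟩ := hR r (hFm r hr).1
    refine ⟨h2, h3, ?_⟩
    have h4 : (c : ℤ) ∣ r.2.1 / Q := by
      rw [← (hFm r hr).2]
      exact Int.gcd_dvd_left _ _
    obtain ⟨k, hk⟩ := h1
    rw [hk, Int.mul_ediv_cancel_left _ hQz] at h4
    rw [hk]
    exact mul_dvd_mul_left _ h4
  have hW : ((F.image fun r ↦ r.2.1).card : ℝ) ≤ 2 * W / (Q * c) := by
    have h1 : ((insert 0 (F.image fun r ↦ r.2.1)).card : ℝ) ≤ 2 * W / (Q * c) + 1 := by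
      have hm' : ∀ w ∈ insert 0 (F.image fun r ↦ r.2.1), |w| ≤ (W : ℤ) ∧ (Q * c : ℤ) ∣ w := by
        intro w hw
        rcases Finset.mem_insert.mp hw with rfl | hw
        · simp
        · exact (hm w hw).2
      exact card_multiples_le (by positivity) (by positivity) _
        (fun z hz ↦ by exact_mod_cast (hm' z hz).1)
        (fun x hx y hy hxy ↦ by
          exact_mod_cast le_sub_of_dvd hxy (dvd_sub (hm' y hy).2 (hm' x hx).2))
    rw [Finset.card_insert_of_notMem (fun h ↦ (hm 0 h).1 rfl)] at h1
    push_cast at h1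
    linarith
  have h1 : (F.card : ℝ) ≤ (4 * Z / Q + 6 * c) * (F.image fun r ↦ r.2.1).card := by
    refine card_le_mul_card_of_fiber_le F _ (fun r ↦ r.2.1)
      (fun r hr ↦ Finset.mem_image_of_mem (fun r : ℤ × ℤ × ℤ ↦ r.2.1) hr) fun w hw ↦ ?_
    obtain ⟨r₀, hr₀, rfl⟩ := Finset.mem_image.mp hw
    set G := F.filter fun r ↦ r.2.1 = r₀.2.1 with hG
    have hGm : ∀ r ∈ G, r ∈ F ∧ r.2.1 = r₀.2.1 := fun r hr ↦ Finset.mem_filter.mp hr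
    have hcard : G.card = (G.image fun r ↦ (r.1, r.2.2)).card :=
      (Finset.card_image_of_injOn fun r hr r' hr' h ↦ by
        simp only [Prod.mk.injEq] at h
        exact Prod.ext h.1 (Prod.ext ((hGm r hr).2.trans (hGm r' hr').2.symm) h.2)).symm
    rw [hcard, ← (hFm r₀ hr₀).2]
    refine card_lattice_points_zero_fiber hQ Z (r₀.2.1 / Q) _ fun t ht ↦ ?_
    obtain ⟨r, hr, rfl⟩ := Finset.mem_image.mp ht
    obtain ⟨h1, h2, h3, h4, -, -, h5⟩ := hR r (hFm r (hGm r hr).1).1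
    rw [(hGm r hr).2] at h3 h4
    refine ⟨h1, h2, ?_, h5⟩
    rwa [Int.mul_ediv_cancel' h3]
  calc (F.card : ℝ) ≤ _ := h1
    _ ≤ (4 * Z / Q + 6 * c) * (2 * W / (Q * c)) := by gcongr
    _ = 8 * Z * W / Q ^ 2 / c + 12 * W / Q := by field_simp; ring
    _ ≤ _ := add_le_add (div_le_self (by positivity) hcr) le_rfl

/-- Points `(a, x, w, z)` of the box `|x| ≤ X`, `|w| ≤ W`, `|z| ≤ Z` in the lattice given by
`w ≡ 2ax (mod Q)` and `z ≡ 3aw - 3a²x (mod Q²)`, with `0 ≤ a < Q`. -/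
noncomputable def latticePoints (Q X W Z : ℕ) : Finset (ℤ × ℤ × ℤ × ℤ) :=
  (Finset.Ico (0 : ℤ) Q ×ˢ Finset.Icc (-X : ℤ) X ×ˢ Finset.Icc (-W : ℤ) W ×ˢ
    Finset.Icc (-Z : ℤ) Z).filter fun r ↦ (Q : ℤ) ∣ r.2.2.1 - 2 * r.1 * r.2.1 ∧
      (Q : ℤ) ^ 2 ∣ r.2.2.2 - (3 * r.1 * r.2.2.1 - 3 * r.1 ^ 2 * r.2.1)

theorem mem_latticePoints {Q X W Z : ℕ} {r : ℤ × ℤ × ℤ × ℤ} :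
    r ∈ latticePoints Q X W Z ↔ (0 ≤ r.1 ∧ r.1 < Q ∧ (Q : ℤ) ∣ r.2.2.1 - 2 * r.1 * r.2.1 ∧
      (Q : ℤ) ^ 2 ∣ r.2.2.2 - (3 * r.1 * r.2.2.1 - 3 * r.1 ^ 2 * r.2.1)) ∧
      |r.2.1| ≤ X ∧ |r.2.2.1| ≤ W ∧ |r.2.2.2| ≤ Z := by
  simp only [latticePoints, Finset.mem_filter, Finset.mem_product, Finset.mem_Ico, Finset.mem_Icc,
    abs_le]
  tauto

/-- The points `(t², t³)` modulo `Q²`, shifted by `x`, lie on a coset of a lattice depending only on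
`t - x` modulo `Q`. -/
theorem shifted_point_congr {Q t u v a x : ℤ} (hu : Q ^ 2 ∣ t ^ 2 - u) (hv : Q ^ 2 ∣ t ^ 3 - v)
    (ha : Q ∣ t - x - a) :
    Q ∣ (u - x ^ 2) - 2 * a * x - a ^ 2 ∧
    Q ^ 2 ∣ (2 * v - 3 * x * u + x ^ 3) -
      (3 * a * (u - x ^ 2) - 3 * a ^ 2 * x) + a ^ 3 := by
  obtain ⟨e₁, h₁⟩ := hu
  obtain ⟨e₂, h₂⟩ := hv
  obtain ⟨b, h₃⟩ := ha
  obtain rfl : t = a + x + Q * b := by linarith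
  obtain rfl : u = (a + x + Q * b) ^ 2 - Q ^ 2 * e₁ := by linarith
  obtain rfl : v = (a + x + Q * b) ^ 3 - Q ^ 2 * e₂ := by linarith
  exact ⟨⟨b * (2 * a + 2 * x + Q * b) - Q * e₁, by ring⟩,
    ⟨b ^ 2 * (3 * (a + x) + 2 * Q * b) + 3 * (a + x) * e₁ - 2 * e₂, by ring⟩⟩

theorem card_mul_le_card_latticePoints {Q : ℕ} (hQ : 0 < Q) {m U V : ℕ} (hmU : m ^ 2 ≤ U)
    (hmV : m * U ≤ V) (S : Finset (ℤ × ℤ))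
    (hS : ∀ p ∈ S, |p.1| ≤ U ∧ |p.2| ≤ V ∧
      ∃ t : ℤ, (Q : ℤ) ^ 2 ∣ t ^ 2 - p.1 ∧ (Q : ℤ) ^ 2 ∣ t ^ 3 - p.2) :
    S.card * (m + 1) ≤ (latticePoints Q m (4 * U) (12 * V)).card := by
  have hQz : (0 : ℤ) < Q := by exact_mod_cast hQ
  choose! hSU hSV t htu htv using hS
  set P : Finset ((ℤ × ℤ) × ℤ) := S ×ˢ Finset.Icc (0 : ℤ) m with hP
  have hPcard : P.card = S.card * (m + 1) := by
    rw [hP, Finset.card_product, Int.card_Icc]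
    congr 1
  set f : (ℤ × ℤ) × ℤ → ℤ := fun y ↦ (t y.1 - y.2) % Q with hf
  rw [← hPcard, Finset.card_eq_sum_card_fiberwise (f := f) (t := Finset.Ico (0 : ℤ) Q)
    (fun y _ ↦ Finset.mem_coe.mpr (Finset.mem_Ico.mpr
      ⟨Int.emod_nonneg _ hQz.ne', Int.emod_lt_of_pos _ hQz⟩)),
    Finset.card_eq_sum_card_fiberwise (f := Prod.fst) (s := latticePoints Q m (4 * U) (12 * V))
      (t := Finset.Ico (0 : ℤ) Q) (fun r hr ↦ by
        obtain ⟨⟨h1, h2, -⟩, -⟩ := mem_latticePoints.mp (Finset.mem_coe.mp hr)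
        exact Finset.mem_coe.mpr (Finset.mem_Ico.mpr ⟨h1, h2⟩))]
  refine Finset.sum_le_sum fun a ha ↦ ?_
  obtain ⟨ha0, haQ⟩ := Finset.mem_Ico.mp ha
  set F := P.filter fun y ↦ f y = a with hF
  rcases F.eq_empty_or_nonempty with h | ⟨y₀, hy₀⟩
  · rw [h]; simp
  set ψ : (ℤ × ℤ) × ℤ → ℤ × ℤ × ℤ := fun y ↦
    (y.2, y.1.1 - y.2 ^ 2, 2 * y.1.2 - 3 * y.2 * y.1.1 + y.2 ^ 3) with hψ
  have hFm : ∀ y ∈ F, y.1 ∈ S ∧ 0 ≤ y.2 ∧ y.2 ≤ m ∧ (Q : ℤ) ∣ t y.1 - y.2 - a := by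
    intro y hy
    obtain ⟨h1, h2⟩ := Finset.mem_filter.mp hy
    obtain ⟨h3, h4⟩ := Finset.mem_product.mp h1
    obtain ⟨h5, h6⟩ := Finset.mem_Icc.mp h4
    exact ⟨h3, h5, h6, h2 ▸ Int.dvd_self_sub_emod⟩
  have hmUz : (m : ℤ) ^ 2 ≤ U := by exact_mod_cast hmU
  have hmVz : (m : ℤ) * U ≤ V := by exact_mod_cast hmV
  have hbox : ∀ y ∈ F, |(ψ y).2.1| ≤ 2 * U ∧ |(ψ y).2.2| ≤ 6 * V := by
    intro y hy
    obtain ⟨h1, h2, h3, -⟩ := hFm y hy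
    have hx2 : y.2 ^ 2 ≤ (U : ℤ) := le_trans (by gcongr) hmUz
    have hx3 : y.2 ^ 3 ≤ (V : ℤ) := by
      calc y.2 ^ 3 = y.2 * y.2 ^ 2 := by ring
        _ ≤ (m : ℤ) * (U : ℤ) := by gcongr
        _ ≤ (V : ℤ) := hmVz
    have hxu : |y.2 * y.1.1| ≤ (V : ℤ) := by
      rw [abs_mul, abs_of_nonneg h2]
      refine le_trans ?_ hmVz
      gcongr
      exact hSU _ h1
    have hu := abs_le.mp (hSU _ h1)
    have hv := abs_le.mp (hSV _ h1)
    have hxu' := abs_le.mp hxu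
    have h20 : 0 ≤ y.2 ^ 2 := by positivity
    have h30 : 0 ≤ y.2 ^ 3 := by positivity
    simp only [hψ, abs_le]
    refine ⟨⟨by linarith, by linarith⟩, ⟨by linarith, by linarith⟩⟩
  refine Finset.card_le_card_of_injOn (fun y ↦ (a, ψ y - ψ y₀)) ?_ ?_
  · intro y hy
    rw [Finset.mem_coe] at hy
    obtain ⟨h1, h2, h3, h4⟩ := hFm y hy
    obtain ⟨h1', h2', h3', h4'⟩ := hFm y₀ hy₀
    obtain ⟨c1, c2⟩ := shifted_point_congr (htu _ h1) (htv _ h1) h4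
    obtain ⟨c1', c2'⟩ := shifted_point_congr (htu _ h1') (htv _ h1') h4'
    obtain ⟨b1, b2⟩ := hbox y hy
    obtain ⟨b1', b2'⟩ := hbox y₀ hy₀
    refine Finset.mem_coe.mpr (Finset.mem_filter.mpr ⟨mem_latticePoints.mpr
      ⟨⟨ha0, haQ, ?_, ?_⟩, ?_, ?_, ?_⟩, rfl⟩)
    · change (Q : ℤ) ∣ ((ψ y).2.1 - (ψ y₀).2.1) - 2 * a * ((ψ y).1 - (ψ y₀).1)
      obtain ⟨k, hk⟩ := dvd_sub c1 c1'
      refine ⟨k, Eq.trans ?_ hk⟩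
      simp only [hψ]
      ring
    · change (Q : ℤ) ^ 2 ∣ ((ψ y).2.2 - (ψ y₀).2.2) - (3 * a * ((ψ y).2.1 - (ψ y₀).2.1) -
        3 * a ^ 2 * ((ψ y).1 - (ψ y₀).1))
      obtain ⟨k, hk⟩ := dvd_sub c2 c2'
      refine ⟨k, Eq.trans ?_ hk⟩
      simp only [hψ]
      ring
    · simp only [hψ, Prod.fst_sub, abs_le]
      constructor <;> linarith
    · change |(ψ y).2.1 - (ψ y₀).2.1| ≤ _
      have := abs_sub (ψ y).2.1 (ψ y₀).2.1
      push_cast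
      linarith
    · change |(ψ y).2.2 - (ψ y₀).2.2| ≤ _
      have := abs_sub (ψ y).2.2 (ψ y₀).2.2
      push_cast
      linarith
  · intro y hy y' hy' h
    simp only [Prod.mk.injEq, true_and, sub_left_inj] at h
    simp only [hψ, Prod.mk.injEq] at h
    obtain ⟨h1, h2, h3⟩ := h
    rw [h1] at h2 h3
    have h4 : y.1.1 = y'.1.1 := by linarith
    rw [h4] at h3
    have h5 : y.1.2 = y'.1.2 := by linarith
    exact Prod.ext (Prod.ext h4 h5) h1

theorem gcd_class_bound {D d Q m U V x w z k : ℝ} (hD : 1 ≤ D) (hd : 0 < d) (hdm : d ≤ m)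
    (hdQ : d ≤ Q) (hQV : Q ≤ V) (hm1 : 1 ≤ m) (hmU : m ^ 2 ≤ U) (hmV : m * U ≤ V) (hx0 : 0 ≤ x)
    (hw0 : 0 ≤ w) (hz0 : 0 ≤ z) (hx : x * d ≤ m) (hw : w * d ≤ 4 * U) (hz : z * d ≤ 12 * V)
    (hk : k * d = Q) :
    3 * d * ((2 * w / k + 1) * (2 * x) + 2 * D * (1 + 2 * √(4 * x * z) +
      (12 * w + 2) * (4 * x * z) / k ^ 2 + 8 * w ^ 2 / k ^ 2)) ≤
    16000 * D * (Q + (m + 1) * V / Q + (m + 1) * U * V / Q ^ 2) := by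
  have hQ : 0 < Q := hd.trans_le hdQ
  have hV : 0 < V := hQ.trans_le hQV
  have hmUle : m ≤ U := by nlinarith
  have hU : 0 < U := by linarith
  have hkpos : 0 < k := by
    rcases lt_or_ge 0 k with h | h
    · exact h
    · nlinarith
  have hxz : (x * d) * (z * d) ≤ m * (12 * V) := by gcongr
  have hwk : w / k ≤ 4 * U / Q := by
    rw [div_le_div_iff₀ hkpos hQ, ← hk]
    nlinarith
  have hB : 4 * x * z / k ^ 2 ≤ 48 * m * V / Q ^ 2 := by
    rw [div_le_div_iff₀ (by positivity) (by positivity), ← hk]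
    have := mul_le_mul_of_nonneg_right hxz (sq_nonneg k)
    nlinarith
  have ht1 : 3 * d * ((2 * w / k + 1) * (2 * x)) ≤ 54 * ((m + 1) * V / Q) := by
    have h1 : m * U / Q ≤ V / Q := by gcongr
    have h2 : m * 1 ≤ m * (V / Q) := by
      gcongr
      rwa [one_le_div hQ]
    calc 3 * d * ((2 * w / k + 1) * (2 * x)) = 6 * (x * d) * (2 * (w / k) + 1) := by ring
      _ ≤ 6 * m * (2 * (4 * U / Q) + 1) := by gcongr
      _ = 48 * (m * U / Q) + 6 * (m * 1) := by ring
      _ ≤ 48 * (V / Q) + 6 * (m * (V / Q)) := by gcongr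
      _ ≤ 54 * ((m + 1) * (V / Q)) := by
        have : 0 ≤ V / Q := by positivity
        have : 0 ≤ m * (V / Q) := by positivity
        linarith
      _ = _ := by ring
  have ht2 : d * √(4 * x * z) ≤ 24 * (m * V / Q) + Q / 2 := by
    rw [← Real.sqrt_sq hd.le, ← Real.sqrt_mul (sq_nonneg d)]
    refine Real.sqrt_le_iff.mpr ⟨by positivity, ?_⟩
    have h1 : m * V / Q * Q = m * V := by field_simp
    nlinarith [sq_nonneg (24 * (m * V / Q) - Q / 2)]
  have ht3 : d * ((12 * w + 2) * (4 * x * z) / k ^ 2) ≤ 2400 * (m * U * V / Q ^ 2) := by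
    calc d * ((12 * w + 2) * (4 * x * z) / k ^ 2)
        = (12 * (w * d) + 2 * d) * (4 * x * z / k ^ 2) := by ring
      _ ≤ (12 * (4 * U) + 2 * U) * (48 * m * V / Q ^ 2) := by
        gcongr
        exact hdm.trans hmUle
      _ = _ := by ring
  have ht4 : d * (8 * w ^ 2 / k ^ 2) ≤ 128 * (U * V / Q ^ 2) := by
    calc d * (8 * w ^ 2 / k ^ 2) = 8 * d * (w / k) ^ 2 := by ring
      _ ≤ 8 * m * (4 * U / Q) ^ 2 := by gcongr
      _ = 128 * (U * (m * U) / Q ^ 2) := by ring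
      _ ≤ 128 * (U * V / Q ^ 2) := by gcongr
  have e1 : 0 ≤ V / Q := by positivity
  have e2 : 0 ≤ m * V / Q := by positivity
  have e3 : 0 ≤ U * V / Q ^ 2 := by positivity
  have e4 : 0 ≤ m * U * V / Q ^ 2 := by positivity
  have s1 : (m + 1) * V / Q = m * V / Q + V / Q := by ring
  have s2 : (m + 1) * U * V / Q ^ 2 = m * U * V / Q ^ 2 + U * V / Q ^ 2 := by ring
  calc _ = 3 * d * ((2 * w / k + 1) * (2 * x)) + 6 * D * (d + 2 * (d * √(4 * x * z)) +
        d * ((12 * w + 2) * (4 * x * z) / k ^ 2) + d * (8 * w ^ 2 / k ^ 2)) := by ring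
    _ ≤ 1 * (54 * ((m + 1) * V / Q)) + 6 * D * (Q + 2 * (24 * (m * V / Q) + Q / 2) +
        2400 * (m * U * V / Q ^ 2) + 128 * (U * V / Q ^ 2)) := by
      rw [one_mul]
      gcongr
    _ ≤ D * (54 * ((m + 1) * V / Q)) + 6 * D * (Q + 2 * (24 * (m * V / Q) + Q / 2) +
        2400 * (m * U * V / Q ^ 2) + 128 * (U * V / Q ^ 2)) := by
      gcongr
    _ = D * (54 * ((m + 1) * V / Q) + 6 * (Q + 2 * (24 * (m * V / Q) + Q / 2) +
        2400 * (m * U * V / Q ^ 2) + 128 * (U * V / Q ^ 2))) := by ring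
    _ ≤ D * (16000 * (Q + (m + 1) * V / Q + (m + 1) * U * V / Q ^ 2)) := by
      gcongr
      rw [s1, s2]
      linarith
    _ = _ := by ring

theorem card_latticePoints_le {Q m U V : ℕ} (hQ : 0 < Q) (hU : 0 < U) (hmU : m ^ 2 ≤ U)
    (hmV : m * U ≤ V) (hQV : Q ≤ V) {D : ℝ} (hD1 : 1 ≤ D)
    (hD : ∀ n : ℕ, n ≠ 0 → n ≤ 4 * m * (12 * V) → (n.divisors.card : ℝ) ≤ D) :
    ((latticePoints Q m (4 * U) (12 * V)).card : ℝ) ≤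
      20000 * D * Q.divisors.card *
        (Q + (m + 1) * V / Q + (m + 1) * U * V / (Q : ℝ) ^ 2) := by
  have hQr : (0 : ℝ) < Q := by exact_mod_cast hQ
  have hQVr : (Q : ℝ) ≤ V := by exact_mod_cast hQV
  have hτ : (1 : ℝ) ≤ Q.divisors.card := by
    exact_mod_cast Finset.card_pos.mpr ⟨1, Nat.one_mem_divisors.mpr hQ.ne'⟩
  set T : ℝ := Q + (m + 1) * V / Q + (m + 1) * U * V / (Q : ℝ) ^ 2 with hT
  set P := latticePoints Q m (4 * U) (12 * V) with hP
  set P₀ := P.filter fun r ↦ r.2.1 = 0 with hP₀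
  set P₁ := P.filter fun r ↦ ¬ r.2.1 = 0 with hP₁
  set P₀₀ := P₀.filter fun r ↦ r.2.2.1 = 0 with hP₀₀
  set P₀₁ := P₀.filter fun r ↦ ¬ r.2.2.1 = 0 with hP₀₁
  have hsplit : (P.card : ℝ) = P₀₀.card + P₀₁.card + P₁.card := by
    have h1 := P.card_filter_add_card_filter_not fun r ↦ r.2.1 = 0
    have h2 := P₀.card_filter_add_card_filter_not fun r ↦ r.2.2.1 = 0
    rw [← h1, ← hP₀, ← h2]
    push_cast
    rfl
  have e1 : (V : ℝ) / Q ≤ (m + 1) * V / Q := by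
    gcongr
    nlinarith [Nat.cast_nonneg (α := ℝ) m, Nat.cast_nonneg (α := ℝ) V]
  have e2 : (U : ℝ) * V / Q ^ 2 ≤ (m + 1) * U * V / (Q : ℝ) ^ 2 := by
    refine div_le_div_of_nonneg_right ?_ (by positivity)
    have : (0 : ℝ) ≤ m * (U * V) := by positivity
    linarith
  have e10 : (0 : ℝ) ≤ V / Q := by positivity
  have e20 : (0 : ℝ) ≤ U * V / Q ^ 2 := by positivity
  have hT0 : 0 ≤ T := by positivity
  have hinj : Set.InjOn (fun r : ℤ × ℤ × ℤ × ℤ ↦ (r.1, r.2.2)) (P₀ : Set (ℤ × ℤ × ℤ × ℤ)) := by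
    intro r hr r' hr' h
    have h1 := (Finset.mem_filter.mp (Finset.mem_coe.mp hr)).2
    have h2 := (Finset.mem_filter.mp (Finset.mem_coe.mp hr')).2
    obtain ⟨h3, h4⟩ := Prod.mk.inj h
    exact Prod.ext h3 (Prod.ext (h1.trans h2.symm) h4)
  have hb00 : (P₀₀.card : ℝ) ≤ 24 * T := by
    rw [← Finset.card_image_of_injOn (hinj.mono (Finset.coe_subset.mpr (Finset.filter_subset _ _)))]
    refine (card_lattice_points_zero_zero hQ (12 * V) _ ?_).trans ?_
    · intro r hr
      obtain ⟨s, hs, rfl⟩ := Finset.mem_image.mp hr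
      obtain ⟨hs0, hw⟩ := Finset.mem_filter.mp hs
      obtain ⟨hsP, hx⟩ := Finset.mem_filter.mp hs0
      obtain ⟨⟨h1, h2, h3, h4⟩, h5, h6, h7⟩ := mem_latticePoints.mp hsP
      refine ⟨h1, h2, hw, ?_, h7⟩
      rw [hx, hw] at h4
      simpa using h4
    · push_cast
      have : (2 : ℝ) * (12 * V) / Q = 24 * (V / Q) := by ring
      linarith
  have hb01 : (P₀₁.card : ℝ) ≤ Q.divisors.card * (432 * T) := by
    rw [← Finset.card_image_of_injOn (hinj.mono (Finset.coe_subset.mpr (Finset.filter_subset _ _)))]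
    refine (card_lattice_points_zero hQ (4 * U) (12 * V) _ ?_).trans ?_
    · intro r hr
      obtain ⟨s, hs, rfl⟩ := Finset.mem_image.mp hr
      obtain ⟨hs0, hw⟩ := Finset.mem_filter.mp hs
      obtain ⟨hsP, hx⟩ := Finset.mem_filter.mp hs0
      obtain ⟨⟨h1, h2, h3, h4⟩, h5, h6, h7⟩ := mem_latticePoints.mp hsP
      refine ⟨h1, h2, ?_, ?_, hw, h6, h7⟩
      · rw [hx] at h3
        simpa using h3
      · rw [hx] at h4
        simpa using h4
    · push_cast
      gcongr
      have h1 : (U : ℝ) / Q ≤ U * V / Q ^ 2 := by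
        rw [div_le_div_iff₀ hQr (by positivity)]
        have : (U : ℝ) * Q * Q ≤ U * Q * V := by gcongr
        linarith
      have h2 : (8 : ℝ) * (12 * V) * (4 * U) / Q ^ 2 + 12 * (4 * U) / Q =
        384 * (U * V / Q ^ 2) + 48 * (U / Q) := by ring
      rw [h2]
      linarith
  have hb1 : (P₁.card : ℝ) ≤ Q.divisors.card * (16000 * D * T) := by
    set f : ℤ × ℤ × ℤ × ℤ → ℕ := fun r ↦
      (Int.gcd r.2.1 r.2.2.1).gcd (Int.gcd r.2.2.2 Q) with hf
    rw [Finset.card_eq_sum_card_fiberwise (f := f) (t := Q.divisors) (fun r _ ↦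
      Finset.mem_coe.mpr (Nat.mem_divisors.mpr ⟨(Nat.gcd_dvd_right _ _).trans
        (Int.natCast_dvd_natCast.mp (Int.gcd_dvd_right _ _)), hQ.ne'⟩))]
    push_cast
    rw [← nsmul_eq_mul, ← Finset.sum_const]
    refine Finset.sum_le_sum fun d hd ↦ ?_
    have hdQ := Nat.dvd_of_mem_divisors hd
    have hdpos := Nat.pos_of_mem_divisors hd
    have hdr : (0 : ℝ) < d := by exact_mod_cast hdpos
    set F := P₁.filter fun r ↦ f r = d with hF
    rcases F.eq_empty_or_nonempty with h | ⟨r₀, hr₀⟩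
    · rw [h, Finset.card_empty, Nat.cast_zero]
      positivity
    have hFm : ∀ r ∈ F, r ∈ P ∧ r.2.1 ≠ 0 ∧ f r = d := fun r hr ↦ by
      obtain ⟨h1, h2⟩ := Finset.mem_filter.mp hr
      obtain ⟨h3, h4⟩ := Finset.mem_filter.mp h1
      exact ⟨h3, h4, h2⟩
    have hdm : d ≤ m := by
      obtain ⟨h1, h2, h3⟩ := hFm r₀ hr₀
      have h4 : d ∣ r₀.2.1.natAbs := h3 ▸ (Nat.gcd_dvd_left _ _).trans
        (Nat.gcd_dvd_left _ _)
      have h5 := Nat.le_of_dvd (Int.natAbs_pos.mpr h2) h4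
      have h6 := (mem_latticePoints.mp h1).2.1
      rw [Int.abs_eq_natAbs] at h6
      have h7 : d ≤ r₀.2.1.natAbs := h5
      omega
    refine (card_lattice_points_of_gcd_eq hQ m (4 * U) (12 * V) hD1 hD hdQ F
      (fun r hr ↦ mem_latticePoints.mp (hFm r hr).1) (fun r hr ↦ (hFm r hr).2.1)
      (fun r hr ↦ (hFm r hr).2.2)).trans ?_
    have key := gcd_class_bound (D := D) (d := d) (Q := Q) (m := m) (U := U) (V := V)
      (x := (m / d : ℕ)) (w := (4 * U / d : ℕ)) (z := (12 * V / d : ℕ)) (k := (Q / d : ℕ))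
      hD1 hdr (by exact_mod_cast hdm) (by exact_mod_cast Nat.le_of_dvd hQ hdQ) hQVr
      (by exact_mod_cast hdpos.trans_le hdm) (by exact_mod_cast hmU) (by exact_mod_cast hmV)
      (Nat.cast_nonneg _) (Nat.cast_nonneg _) (Nat.cast_nonneg _)
      (by exact_mod_cast Nat.div_mul_le_self m d)
      (by exact_mod_cast Nat.div_mul_le_self (4 * U) d)
      (by exact_mod_cast Nat.div_mul_le_self (12 * V) d)
      (by exact_mod_cast Nat.div_mul_cancel hdQ)
    simpa only [Nat.cast_mul, Nat.cast_ofNat] using key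
  rw [hsplit]
  have hDτ : (1 : ℝ) ≤ D * Q.divisors.card := one_le_mul_of_one_le_of_one_le hD1 hτ
  have g1 : 24 * T ≤ 24 * (D * Q.divisors.card * T) := by
    have := mul_le_mul_of_nonneg_right hDτ hT0
    linarith
  have g2 : Q.divisors.card * (432 * T) ≤ 432 * (D * Q.divisors.card * T) := by
    have := mul_le_mul_of_nonneg_right hD1 (show 0 ≤ Q.divisors.card * T by positivity)
    linarith
  have g3 : 0 ≤ D * Q.divisors.card * T := by positivity
  linarith

theorem exists_sq_cube_approx {N u v : ℤ} (h : v ^ 2 ≡ u ^ 3 [ZMOD N]) (hu : IsCoprime u N) :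
    ∃ t : ℤ, N ∣ t ^ 2 - u ∧ N ∣ t ^ 3 - v := by
  obtain ⟨s, r, hs⟩ := hu
  obtain ⟨e, he⟩ := h.dvd
  have hv : v ^ 2 = u ^ 3 - N * e := by linarith
  have hsu : s * u = 1 - r * N := by linarith
  refine ⟨s * v, ⟨-(s ^ 2 * e) + u * (r ^ 2 * N - 2 * r), ?_⟩,
    ⟨-(s ^ 3 * v * e) + v * (-3 * r + 3 * r ^ 2 * N - r ^ 3 * N ^ 2), ?_⟩⟩
  · calc (s * v) ^ 2 - u = s ^ 2 * v ^ 2 - u := by ring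
      _ = (s * u) ^ 2 * u - s ^ 2 * (N * e) - u := by rw [hv]; ring
      _ = _ := by rw [hsu]; ring
  · calc (s * v) ^ 3 - v = s ^ 3 * v * v ^ 2 - v := by ring
      _ = (s * u) ^ 3 * v - s ^ 3 * v * (N * e) - v := by rw [hv]; ring
      _ = _ := by rw [hsu]; ring

/-- For `|v| ≤ V < Q`, the residue of `v²` modulo `Q²` determines `v` up to sign. -/
theorem card_le_of_lt {Q U V : ℕ} (hQV : V < Q) (S : Finset (ℤ × ℤ))
    (hS : ∀ p ∈ S, |p.1| ≤ U ∧ |p.2| ≤ V ∧ p.2 ^ 2 ≡ p.1 ^ 3 [ZMOD (Q : ℤ) ^ 2]) :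
    (S.card : ℝ) ≤ 2 * (2 * U + 1) := by
  have h := card_le_mul_card_of_fiber_le S (Finset.Icc (-U : ℤ) U) Prod.fst (c := 2)
    (fun p hp ↦ Finset.mem_Icc.mpr (abs_le.mp (hS p hp).1)) (fun u _ ↦ by
      set F := S.filter fun p ↦ p.1 = u with hF
      rcases F.eq_empty_or_nonempty with h | ⟨p₀, hp₀⟩
      · rw [h]; simp
      · have hsub : F ⊆ {(u, p₀.2), (u, -p₀.2)} := by
          intro p hp
          obtain ⟨h1, h2⟩ := Finset.mem_filter.mp hp
          obtain ⟨h3, h4⟩ := Finset.mem_filter.mp hp₀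
          obtain ⟨-, a1, a2⟩ := hS p h1
          obtain ⟨-, b1, b2⟩ := hS p₀ h3
          rw [h2] at a2
          rw [h4] at b2
          have hVQ : (V : ℤ) < Q := by exact_mod_cast hQV
          have hlt : ∀ x : ℤ, |x| ≤ V → x ^ 2 < (Q : ℤ) ^ 2 := fun x hx ↦
            sq_lt_sq.mpr ((hx.trans_lt hVQ).trans_le (le_abs_self _))
          have heq := a2.trans b2.symm
          rw [Int.ModEq, Int.emod_eq_of_lt (sq_nonneg _) (hlt _ a1),
            Int.emod_eq_of_lt (sq_nonneg _) (hlt _ b1)] at heq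
          rw [Finset.mem_insert, Finset.mem_singleton]
          rcases sq_eq_sq_iff_eq_or_eq_neg.mp heq with h5 | h5
          · exact Or.inl (Prod.ext h2 h5)
          · exact Or.inr (Prod.ext h2 h5)
        exact_mod_cast (Finset.card_le_card hsub).trans Finset.card_le_two)
  have hcard : ((Finset.Icc (-U : ℤ) U).card : ℝ) = 2 * U + 1 := by
    rw [Int.card_Icc]
    have : ((U : ℤ) + 1 - -U).toNat = 2 * U + 1 := by omega
    rw [this]
    push_cast
    ring
  rwa [hcard] at h

theorem exists_finset_card_eq_Mcount {U V : ℝ} (hU : 0 ≤ U) (hV : 0 ≤ V) (q : ℤ) :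
    ∃ S : Finset (ℤ × ℤ), S.card = Mcount U V q ∧ ∀ p ∈ S, |p.1| ≤ (⌊U⌋₊ : ℤ) ∧
      |p.2| ≤ (⌊V⌋₊ : ℤ) ∧ p.2 ^ 2 ≡ p.1 ^ 3 [ZMOD q ^ 4] ∧ IsCoprime p.1 q := by
  have habs : ∀ {X : ℝ} {x : ℤ}, 0 ≤ X → (|x| : ℝ) ≤ X → |x| ≤ (⌊X⌋₊ : ℤ) := by
    intro X x hX hx
    rw [Int.abs_eq_natAbs]
    refine Int.ofNat_le.mpr (Nat.le_floor ?_)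
    rwa [Nat.cast_natAbs, Int.cast_abs]
  set A : Set (ℤ × ℤ) := {t | t.2 ^ 2 ≡ t.1 ^ 3 [ZMOD q ^ 4] ∧
    (|t.1| : ℝ) ≤ U ∧ (|t.2| : ℝ) ≤ V ∧ Int.gcd (t.1 * t.2) q = 1} with hA
  have hfin : A.Finite := by
    refine (Set.finite_Icc ((-⌊U⌋₊, -⌊V⌋₊) : ℤ × ℤ) (⌊U⌋₊, ⌊V⌋₊)).subset ?_
    rintro t ⟨-, h1, h2, -⟩
    obtain ⟨h3, h4⟩ := abs_le.mp (habs hU h1)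
    obtain ⟨h5, h6⟩ := abs_le.mp (habs hV h2)
    exact ⟨⟨h3, h5⟩, ⟨h4, h6⟩⟩
  refine ⟨hfin.toFinset, (Nat.card_eq_card_finite_toFinset hfin).symm, fun p hp ↦ ?_⟩
  obtain ⟨h1, h2, h3, h4⟩ := hfin.mem_toFinset.mp hp
  exact ⟨habs hU h2, habs hV h3, h1, (Int.isCoprime_iff_gcd_eq_one.mpr h4).of_mul_left_left⟩

theorem Mcount_le_of_lt {U V : ℝ} (hU : 1 ≤ U) (hV : 1 ≤ V) {q : ℤ} (h : V < q ^ 2) :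
    (Mcount U V q : ℝ) ≤ 6 * (q ^ 2 * U / V) := by
  obtain ⟨S, hcard, hS⟩ := exists_finset_card_eq_Mcount (by linarith) (by linarith) q
    (U := U) (V := V)
  have hQ : (((q ^ 2).natAbs : ℕ) : ℤ) = q ^ 2 := Int.natAbs_of_nonneg (sq_nonneg q)
  have hlt : ⌊V⌋₊ < (q ^ 2).natAbs := by
    rw [Nat.floor_lt (by linarith), ← Int.cast_natCast, hQ]
    exact_mod_cast h
  have h1 := card_le_of_lt (U := ⌊U⌋₊) hlt S fun p hp ↦ by
    obtain ⟨h1, h2, h3, -⟩ := hS p hp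
    refine ⟨h1, h2, ?_⟩
    rwa [hQ, ← pow_mul]
  rw [← hcard]
  have h2 : (⌊U⌋₊ : ℝ) ≤ U := Nat.floor_le (by linarith)
  have h3 : U ≤ q ^ 2 * U / V := by
    rw [le_div_iff₀ (by linarith), mul_comm]
    gcongr
  linarith

theorem Mcount_le_of_le {U V : ℝ} (hU : 1 ≤ U) (hV : 1 ≤ V) {q : ℤ} (hq : 1 ≤ q)
    (h : q ^ 2 ≤ V) {D : ℝ} (hD1 : 1 ≤ D)
    (hD : ∀ n : ℕ, n ≠ 0 → (n : ℝ) ≤ 48 * (U * V) → (n.divisors.card : ℝ) ≤ D) :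
    (Mcount U V q : ℝ) ≤ 20000 * D * (q.natAbs ^ 2).divisors.card *
      (U * V / q ^ 4 + V / q ^ 2 + q ^ 2 * U / V + q ^ 2 / √U) := by
  obtain ⟨S, hcard, hS⟩ := exists_finset_card_eq_Mcount (by linarith) (by linarith) q
    (U := U) (V := V)
  set Q : ℕ := q.natAbs ^ 2 with hQdef
  have hQz : (Q : ℤ) = q ^ 2 := by
    rw [hQdef]
    push_cast
    exact sq_abs q
  have hQr : (Q : ℝ) = q ^ 2 := by exact_mod_cast congrArg (Int.cast (R := ℝ)) hQz
  have hQ : 0 < Q := by positivity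
  have hQpos : (0 : ℝ) < Q := by exact_mod_cast hQ
  have hU0 : 0 < U := by linarith
  have hV0 : 0 < V := by linarith
  have hsU : 0 < √U := Real.sqrt_pos.mpr hU0
  set u : ℕ := ⌊U⌋₊ with hu
  set v : ℕ := ⌊V⌋₊ with hv
  set m : ℕ := ⌊min (√U) (V / U)⌋₊ with hm
  have huU : (u : ℝ) ≤ U := Nat.floor_le hU0.le
  have hvV : (v : ℝ) ≤ V := Nat.floor_le hV0.le
  have hmle : (m : ℝ) ≤ min (√U) (V / U) := Nat.floor_le (by positivity)
  have hmU : m ^ 2 ≤ u := by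
    refine Nat.le_floor ?_
    push_cast
    calc (m : ℝ) ^ 2 ≤ √U ^ 2 := by
          gcongr
          exact hmle.trans (min_le_left _ _)
      _ = U := Real.sq_sqrt hU0.le
  have hmV' : (m : ℝ) * U ≤ V := (le_div_iff₀ hU0).mp (hmle.trans (min_le_right _ _))
  have hmV : m * u ≤ v := by
    refine Nat.le_floor ?_
    push_cast
    exact le_trans (by gcongr) hmV'
  have hQv : Q ≤ v := Nat.le_floor (by rw [hQr]; exact h)
  have hu0 : 0 < u := Nat.floor_pos.mpr hU
  have hmUle : (m : ℝ) ≤ U := by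
    have : m ≤ u := (Nat.le_self_pow two_ne_zero m).trans hmU
    exact le_trans (by exact_mod_cast this) huU
  have h1 := card_mul_le_card_latticePoints hQ hmU hmV S fun p hp ↦ by
    obtain ⟨h1, h2, h3, h4⟩ := hS p hp
    refine ⟨h1, h2, ?_⟩
    rw [hQz, ← pow_mul]
    exact exists_sq_cube_approx h3 h4.pow_right
  have h2 := card_latticePoints_le hQ hu0 hmU hmV hQv hD1 fun n hn0 hn ↦ hD n hn0 <| by
    calc (n : ℝ) ≤ (4 * m * (12 * v) : ℕ) := by exact_mod_cast hn
      _ = 48 * (m * v) := by push_cast; ring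
      _ ≤ 48 * (U * V) := by gcongr
  have h3 : (S.card : ℝ) * (m + 1) ≤ _ := le_trans (by exact_mod_cast h1) h2
  have hL : (0 : ℝ) < m + 1 := by positivity
  have h4 : (Q : ℝ) / (m + 1) ≤ Q * U / V + Q / √U := by
    have h5 : min (√U) (V / U) ≤ m + 1 := (Nat.lt_floor_add_one _).le
    rcases min_le_iff.mp h5 with h6 | h6
    · have : (Q : ℝ) / (m + 1) ≤ Q / √U := by gcongr
      have : 0 ≤ Q * U / V := by positivity
      linarith
    · have : (Q : ℝ) / (m + 1) ≤ Q / (V / U) := by gcongr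
      have h7 : (Q : ℝ) / (V / U) = Q * U / V := by field_simp
      have : 0 ≤ Q / √U := by positivity
      linarith
  rw [← hcard]
  calc (S.card : ℝ) ≤ 20000 * D * Q.divisors.card *
        (Q + (m + 1) * v / Q + (m + 1) * u * v / (Q : ℝ) ^ 2) / (m + 1) :=
        (le_div_iff₀ hL).mpr h3
    _ = 20000 * D * Q.divisors.card *
        (Q / (m + 1) + v / Q + u * v / (Q : ℝ) ^ 2) := by field_simp
    _ ≤ 20000 * D * Q.divisors.card *
        (Q * U / V + Q / √U + V / Q + U * V / (Q : ℝ) ^ 2) := by gcongr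
    _ = _ := by rw [hQr]; ring

/-- Baier–Browning bound for `ℳ(U, V, q)`. -/
theorem Mcount_bound (ε : ℝ) (hε : 0 < ε) :
    ∃ C : ℝ, 0 < C ∧ ∀ U V : ℝ, 1 ≤ U → 1 ≤ V → ∀ q : ℤ, 1 ≤ q →
      (Mcount U V q : ℝ) ≤ C * (U * V * q) ^ ε *
        (U * V / q ^ 4 + V / q ^ 2 + U ^ ((3 : ℝ) / 4) * V ^ ((1 : ℝ) / 2) / q ^ 2 +
          q ^ 2 * U / V + q ^ 2 / U ^ ((1 : ℝ) / 2)) := by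
  obtain ⟨C, hC1, hC⟩ := exists_card_divisors_le_rpow (half_pos hε)
  have hC0 : 0 < C := by linarith
  refine ⟨20000 * C ^ 2 * 48 ^ (ε / 2), by positivity, fun U V hU hV q hq ↦ ?_⟩
  have hU0 : 0 < U := by linarith
  have hV0 : 0 < V := by linarith
  have hqr : (1 : ℝ) ≤ q := by exact_mod_cast hq
  have hq0 : (0 : ℝ) < q := by linarith
  have hUV : 1 ≤ U * V := one_le_mul_of_one_le_of_one_le hU hV
  have h48 : (1 : ℝ) ≤ 48 ^ (ε / 2) := Real.one_le_rpow (by norm_num) (by positivity)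
  set E := U * V / q ^ 4 + V / q ^ 2 + q ^ 2 * U / V + q ^ 2 / √U with hE
  have hE0 : 0 ≤ E := by positivity
  suffices hmain : (Mcount U V q : ℝ) ≤ 20000 * C ^ 2 * 48 ^ (ε / 2) * (U * V * q) ^ ε * E by
    refine hmain.trans ?_
    gcongr
    rw [hE, ← Real.sqrt_eq_rpow U]
    have : 0 ≤ U ^ ((3 : ℝ) / 4) * V ^ ((1 : ℝ) / 2) / q ^ 2 := by positivity
    linarith
  rcases lt_or_ge V (q ^ 2) with h | h
  · refine (Mcount_le_of_lt hU hV h).trans ?_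
    have h1 : (6 : ℝ) ≤ 20000 * C ^ 2 * 48 ^ (ε / 2) * (U * V * q) ^ ε := by
      have h2 : (1 : ℝ) ≤ C ^ 2 := one_le_pow₀ hC1
      have h3 : 1 ≤ (U * V * q) ^ ε :=
        Real.one_le_rpow (one_le_mul_of_one_le_of_one_le hUV hqr) hε.le
      have h4 := one_le_mul_of_one_le_of_one_le (one_le_mul_of_one_le_of_one_le h2 h48) h3
      linarith
    gcongr
    have : 0 ≤ U * V / q ^ 4 + V / q ^ 2 + q ^ 2 / √U := by positivity
    linarith
  · have hUVε : 1 ≤ (48 * (U * V)) ^ (ε / 2) :=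
      Real.one_le_rpow (by linarith) (by positivity)
    refine (Mcount_le_of_le hU hV hq h (D := C * (48 * (U * V)) ^ (ε / 2))
      (one_le_mul_of_one_le_of_one_le hC1 hUVε) fun n hn0 hn ↦ ?_).trans ?_
    · refine (hC n hn0).trans ?_
      gcongr
    · rw [← hE]
      refine mul_le_mul_of_nonneg_right ?_ hE0
      have hτ : ((q.natAbs ^ 2).divisors.card : ℝ) ≤ C * (q : ℝ) ^ ε := by
        refine (hC _ (by positivity)).trans_eq ?_
        rw [Nat.cast_pow, Nat.cast_natAbs, abs_of_nonneg (by linarith), ← Real.rpow_natCast,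
          ← Real.rpow_mul hq0.le]
        congr 2
        push_cast
        ring
      have hUV2 : (U * V) ^ (ε / 2) ≤ (U * V) ^ ε :=
        Real.rpow_le_rpow_of_exponent_le hUV (by linarith)
      calc 20000 * (C * (48 * (U * V)) ^ (ε / 2)) * ((q.natAbs ^ 2).divisors.card : ℝ)
          ≤ 20000 * (C * (48 ^ (ε / 2) * (U * V) ^ ε)) * (C * (q : ℝ) ^ ε) := by
            rw [Real.mul_rpow (by norm_num) (by positivity)]
            gcongr
        _ = 20000 * C ^ 2 * 48 ^ (ε / 2) * (U * V * q) ^ ε := by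
            rw [Real.mul_rpow (by positivity) hq0.le]
            ring
end
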